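/- Let 0 < R < T, let q₁, q₂ be C⁸ functions on ℝ³, and let u₁, u₂ be C² solutions of the Goursat problems for q₁ and q₂ respectively on the cone {(x,t) : t ≥ |x|}. Set q = q₁ − q₂, vᵢ(x,t) = |x| uᵢ(x,t), v = v₁ − v₂, and p(x) = ∫₀^{|x|} q(σ x/|x|) dσ. Let A = {x : R ≤ |x| ≤ (R+T)/2}, C = {(x,t) : |x| = R, R ≤ t ≤ T}, K = {(x,t) : R ≤ |x| ≤ (R+T)/2, |x| ≤ t ≤ R+T−|x|}. Suppose v = 0 and ∂_r v = 0 at every point of C, and fix 1 ≤ i < j ≤ 3. Then there is a constant c > 0 depending only on R, T, the C¹ norm of q₁ on A and the C¹ norm of v₂ on K such that ∫_K |x|^{-4} (Ω_{ij} ∂_r v)² dx dt ≤ c (T−R) R^{-2} [ ∫_A |x|^{-2} ( p² + |∇p|² + |∇(Ω_{ij} p)|² ) dx + ∫_K |x|^{-2} v² dx dt ], where ∇ denotes the spatial gradient. -/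

import Mathlib

noncomputable section

open Real MeasureTheory Metric Set

/-- Euclidean 3-space. -/
abbrev E3 : Type := EuclideanSpace ℝ (Fin 3)

/-- The `i`-th standard basis vector of `ℝ³`. -/
def basis3 (i : Fin 3) : E3 := EuclideanSpace.single i 1

/-- The partial derivative `∂ᵢ f` of a function on `ℝ³`. -/
def pd (i : Fin 3) (f : E3 → ℝ) (x : E3) : ℝ := fderiv ℝ f x (basis3 i)

/-- The Laplacian `Δf` on `ℝ³`. -/
def lap (f : E3 → ℝ) (x : E3) : ℝ := ∑ i, pd i (pd i f) x

/-- The radial derivative `∂_r f(x) = (x/|x|)·∇f(x)`. -/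
def pdr (f : E3 → ℝ) (x : E3) : ℝ := ‖x‖⁻¹ * ∑ i, x i * pd i f x

/-- The angular derivative `Ω_{ij} f = xᵢ ∂ⱼ f − xⱼ ∂ᵢ f`. -/
def ang (i j : Fin 3) (f : E3 → ℝ) (x : E3) : ℝ := x i * pd j f x - x j * pd i f x

/-- `Ω f = Σ_{i<j} Ω_{ij}(Ω_{ij} f)`. -/
def angLap (f : E3 → ℝ) (x : E3) : ℝ :=
  ∑ i, ∑ j, if i < j then ang i j (ang i j f) x else 0

/-- The squared length `|∇f(x)|²` of the gradient. -/
def gradsq (f : E3 → ℝ) (x : E3) : ℝ := ∑ i, (pd i f x) ^ 2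

/-- `Σ_{i<j} (Ω_{ij} g)²`. -/
def angsq (g : E3 → ℝ) (x : E3) : ℝ := ∑ i, ∑ j, if i < j then (ang i j g x) ^ 2 else 0

/-- `Σ_{i<j} Σ_{k<l} (Ω_{kl} Ω_{ij} g)²`. -/
def angsq2 (g : E3 → ℝ) (x : E3) : ℝ :=
  ∑ i, ∑ j, ∑ k, ∑ l, if i < j ∧ k < l then (ang k l (ang i j g) x) ^ 2 else 0

/-- The time derivative `∂_t u` of a space-time function. -/
def pdt (u : E3 × ℝ → ℝ) (p : E3 × ℝ) : ℝ := fderiv ℝ u p (0, 1)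

/-- The spatial slice `x ↦ u(x,t)` of a space-time function, at fixed time `t`. -/
def fixT (u : E3 × ℝ → ℝ) (t : ℝ) : E3 → ℝ := fun y => u (y, t)

/-- The spatial partial derivative `∂ᵢ u` of a space-time function (`t` fixed). -/
def pdx (i : Fin 3) (u : E3 × ℝ → ℝ) (p : E3 × ℝ) : ℝ := pd i (fixT u p.2) p.1

/-- The spatial radial derivative `∂_r u` of a space-time function (`t` fixed). -/
def pdrX (u : E3 × ℝ → ℝ) (p : E3 × ℝ) : ℝ := pdr (fixT u p.2) p.1

/-- The spatial angular derivative `Ω_{ij} u` of a space-time function (`t` fixed). -/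
def angX (i j : Fin 3) (u : E3 × ℝ → ℝ) (p : E3 × ℝ) : ℝ := ang i j (fixT u p.2) p.1

/-- The spatial operator `Ω u` of a space-time function (`t` fixed). -/
def angLapX (u : E3 × ℝ → ℝ) (p : E3 × ℝ) : ℝ := angLap (fixT u p.2) p.1

/-- The spatial Laplacian `Δu` of a space-time function (`t` fixed). -/
def lapX (u : E3 × ℝ → ℝ) (p : E3 × ℝ) : ℝ := lap (fixT u p.2) p.1

/-- The squared spatial gradient `|∇u|²` of a space-time function (`t` fixed). -/
def gradsqX (u : E3 × ℝ → ℝ) (p : E3 × ℝ) : ℝ := gradsq (fixT u p.2) p.1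

/-- `Σ_{i<j} (Ω_{ij} w)²` for a space-time function (`t` fixed). -/
def angsqX (w : E3 × ℝ → ℝ) (p : E3 × ℝ) : ℝ :=
  ∑ i, ∑ j, if i < j then (angX i j w p) ^ 2 else 0

/-- The solid light cone `t ≥ |x|`. -/
def cone : Set (E3 × ℝ) := {p | ‖p.1‖ ≤ p.2}

/-- `u` is a C² solution of the Goursat problem for `q` on the cone `t ≥ |x|`:
`∂_t²u − Δu − q u = 0` for `t > |x|` and `u(x,|x|) = ∫₀¹ q(σx) dσ`. -/
def GoursatSol (q : E3 → ℝ) (u : E3 × ℝ → ℝ) : Prop :=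
  ContDiffOn ℝ 2 u cone ∧
  (∀ p : E3 × ℝ, ‖p.1‖ < p.2 → pdt (pdt u) p - lapX u p - q p.1 * u p = 0) ∧
  (∀ x : E3, u (x, ‖x‖) = ∫ σ in (0:ℝ)..1, q (σ • x))

/-- `p(x) = ∫₀^{|x|} q(σ x/|x|) dσ`. -/
def pfun (q : E3 → ℝ) (x : E3) : ℝ := ∫ σ in (0:ℝ)..‖x‖, q ((σ / ‖x‖) • x)

/-- Integral over the sphere of radius `r` with respect to surface measure. -/
def sphInt (r : ℝ) (g : E3 → ℝ) : ℝ := ∫ x in sphere (0:E3) r, g x ∂μH[2]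

/-- Squared `L²` norm on the sphere of radius `r`. -/
def L2sq (g : E3 → ℝ) (r : ℝ) : ℝ := sphInt r (fun x => (g x) ^ 2)

/-- Squared `H¹` norm on the sphere of radius `r`. -/
def H1sq (g : E3 → ℝ) (r : ℝ) : ℝ := sphInt r (fun x => (g x) ^ 2 + (r ^ 2)⁻¹ * angsq g x)

/-- Squared `H²` norm on the sphere of radius `r`. -/
def H2sq (g : E3 → ℝ) (r : ℝ) : ℝ := H1sq g r + sphInt r (fun x => (r ^ 4)⁻¹ * angsq2 g x)

/-- The class `Q_γ(R,T)`. -/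
def memQ (R T γ : ℝ) (q : E3 → ℝ) : Prop :=
  ∀ r ∈ Icc R ((R + T) / 2),
    Real.sqrt (H2sq (pfun q) r) + Real.sqrt (H1sq (pdr (pfun q)) r) ≤
      γ * (Real.sqrt (H1sq (pfun q) r) + Real.sqrt (L2sq (pdr (pfun q)) r))

/-- The closed annulus `R ≤ |x| ≤ ρ` in `ℝ³`. -/
def Ann (R ρ : ℝ) : Set E3 := {x | R ≤ ‖x‖ ∧ ‖x‖ ≤ ρ}

/-- The space-time region `K_ρ = {R ≤ |x| ≤ ρ, |x| ≤ t ≤ R+T−|x|}`. -/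
def Kreg (R T ρ : ℝ) : Set (E3 × ℝ) :=
  {p | R ≤ ‖p.1‖ ∧ ‖p.1‖ ≤ ρ ∧ ‖p.1‖ ≤ p.2 ∧ p.2 ≤ R + T - ‖p.1‖}

/-- `F = ∂_t²w − ∂_r∂_r w − |x|^{-2} Ω w`. -/
def Fop (w : E3 × ℝ → ℝ) (p : E3 × ℝ) : ℝ :=
  pdt (pdt w) p - pdrX (pdrX w) p - (‖p.1‖ ^ 2)⁻¹ * angLapX w p

/-- The sideways energy `J(ρ)`. -/
def Jfun (R T : ℝ) (w : E3 × ℝ → ℝ) (ρ : ℝ) : ℝ :=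
  ∫ t in ρ..(R + T - ρ), sphInt ρ
    (fun x => (ρ ^ 2)⁻¹ * ((w (x, t)) ^ 2 + (pdt w (x, t)) ^ 2 + gradsqX w (x, t)))

open Filter Topology

lemma countable_norm_add_smul_eq (x v : E3) (hv : v ≠ 0) (R : ℝ) :
    {t : ℝ | ‖x + t • v‖ = R}.Countable := by
  set p : Polynomial ℝ := Polynomial.C (‖v‖ ^ 2) * Polynomial.X ^ 2
    + Polynomial.C (2 * inner ℝ x v) * Polynomial.X + Polynomial.C (‖x‖ ^ 2 - R ^ 2) with hp
  have hp0 : p ≠ 0 := by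
    intro h
    have : p.coeff 2 = 0 := by rw [h]; simp
    rw [hp, Polynomial.coeff_add, Polynomial.coeff_add] at this
    simp only [Polynomial.coeff_C_mul, Polynomial.coeff_X_pow, Polynomial.coeff_X,
      Polynomial.coeff_C] at this
    norm_num at this
    exact hv this
  refine ((Polynomial.finite_setOfPred_isRoot hp0).subset ?_).countable
  intro t ht
  have ht' : ‖x + t • v‖ = R := ht
  have h2 := norm_add_sq_real x (t • v)
  rw [ht', inner_smul_right, norm_smul, mul_pow, Real.norm_eq_abs, sq_abs] at h2
  change p.IsRoot t
  simp only [hp, Polynomial.IsRoot, Polynomial.eval_add, Polynomial.eval_mul, Polynomial.eval_C,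
    Polynomial.eval_pow, Polynomial.eval_X]
  linarith

lemma lipschitzWith_of_hasFDerivAt_off_spheres {f : E3 → ℝ} (hf : Continuous f) {R ρ : ℝ}
    {L : NNReal} (hd : ∀ x : E3, ‖x‖ ≠ R → ‖x‖ ≠ ρ → ∃ f' : E3 →L[ℝ] ℝ,
      HasFDerivAt f f' x ∧ ‖f'‖ ≤ L) : LipschitzWith L f := by
  refine LipschitzWith.of_dist_le_mul fun x y => ?_
  rcases eq_or_ne y x with rfl | hxy
  · simp
  have hv : x - y ≠ 0 := sub_ne_zero.2 hxy.symm
  set v := x - y with hvdef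
  set g : ℝ → ℝ := fun t => f (y + t • v) with hg
  set s : Set ℝ := {t : ℝ | ‖y + t • v‖ = R} ∪ {t : ℝ | ‖y + t • v‖ = ρ} with hs
  have hsc : s.Countable :=
    (countable_norm_add_smul_eq y v hv R).union (countable_norm_add_smul_eq y v hv ρ)
  have hder : ∀ t ∉ s, HasDerivAt g (deriv g t) t ∧ ‖deriv g t‖ ≤ L * ‖v‖ := by
    intro t ht
    simp only [hs, mem_union, mem_ofPred_eq, not_or] at ht
    obtain ⟨f', hf', hb⟩ := hd _ ht.1 ht.2
    have h1 : HasDerivAt (fun t : ℝ => y + t • v) v t := by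
      simpa using ((hasDerivAt_id t).smul_const v).const_add y
    have h2 : HasDerivAt g (f' v) t := hf'.comp_hasDerivAt t h1
    rw [h2.deriv]
    exact ⟨h2, (f'.le_opNorm v).trans (by gcongr)⟩
  have hae : ∀ᵐ t : ℝ, t ∉ s := by
    have := hsc.measure_zero volume
    exact measure_eq_zero_iff_ae_notMem.1 this
  have hfint : IntervalIntegrable (deriv g) volume 0 1 := by
    refine IntervalIntegrable.mono_fun' (g := fun _ => (L : ℝ) * ‖v‖)
      intervalIntegrable_const (measurable_deriv g).aestronglyMeasurable ?_
    filter_upwards [ae_restrict_of_ae hae] with t ht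
    exact (hder t ht).2
  have hcont : Continuous g := by fun_prop
  have hftc := integral_eq_of_hasDerivAt_off_countable g (deriv g) (a := 0) (b := 1) hsc
    hcont.continuousOn (fun t ht => (hder t ht.2).1) hfint
  have hbd : ‖∫ t in (0:ℝ)..1, deriv g t‖ ≤ (L * ‖v‖) * |1 - 0| := by
    refine intervalIntegral.norm_integral_le_of_norm_le_const_ae ?_
    filter_upwards [hae] with t ht _ using (hder t ht).2
  rw [hftc] at hbd
  simp only [hg, hvdef, one_smul, zero_smul, add_zero, add_sub_cancel, sub_zero, abs_one,
    mul_one] at hbd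
  rw [dist_eq_norm, dist_eq_norm]
  exact hbd

lemma ae_norm_ne (R : ℝ) : ∀ᵐ x : E3, ‖x‖ ≠ R := by
  have := Measure.addHaar_sphere (volume : Measure E3) 0 R
  filter_upwards [measure_eq_zero_iff_ae_notMem.1 this] with x hx
  simpa using hx

lemma measurableSet_Ann (R ρ : ℝ) : MeasurableSet (Ann R ρ) :=
  (measurableSet_le measurable_const measurable_norm).inter
    (measurableSet_le measurable_norm measurable_const)

lemma isCompact_Ann (R ρ : ℝ) : IsCompact (Ann R ρ) := by
  refine (isCompact_closedBall (0 : E3) ρ).of_isClosed_subset ?_ ?_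
  · exact (isClosed_le continuous_const continuous_norm).inter
      (isClosed_le continuous_norm continuous_const)
  · intro x hx
    simpa using hx.2

/-- The integral of a directional derivative over an annulus vanishes for functions vanishing on
both boundary spheres. -/
lemma integral_Ann_fderiv_eq_zero {R ρ : ℝ} {φ : E3 → ℝ} {φ' : E3 → E3 →L[ℝ] ℝ}
    {L : ℝ} (hφ : ContinuousOn φ (Ann R ρ))
    (hR : ∀ x, ‖x‖ = R → φ x = 0) (hρ : ∀ x, ‖x‖ = ρ → φ x = 0)
    (hd : ∀ x, R < ‖x‖ → ‖x‖ < ρ → HasFDerivAt φ (φ' x) x ∧ ‖φ' x‖ ≤ L) (e : E3) :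
    ∫ x in Ann R ρ, φ' x e = 0 := by
  classical
  set F : E3 → ℝ := (Ann R ρ).piecewise φ 0 with hF
  have hLL : L ≤ L.toNNReal := Real.le_coe_toNNReal L
  have hfr : ∀ x ∈ frontier (Ann R ρ), ‖x‖ = R ∨ ‖x‖ = ρ := by
    intro x hx
    have hcl : IsClosed (Ann R ρ) := (isCompact_Ann R ρ).isClosed
    have hxA : x ∈ Ann R ρ := hcl.frontier_subset hx
    by_contra! hcon
    have h1 : R < ‖x‖ := lt_of_le_of_ne hxA.1 (Ne.symm hcon.1)
    have h2 : ‖x‖ < ρ := lt_of_le_of_ne hxA.2 hcon.2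
    have : x ∈ interior (Ann R ρ) := by
      rw [mem_interior_iff_mem_nhds]
      filter_upwards [continuous_norm.continuousAt.eventually (lt_mem_nhds h1),
        continuous_norm.continuousAt.eventually (gt_mem_nhds h2)] with y hy1 hy2
      exact ⟨le_of_lt hy1, le_of_lt hy2⟩
    exact hx.2 this
  have hFc : Continuous F := by
    refine continuous_piecewise ?_ ?_ continuousOn_const
    · intro x hx
      rcases hfr x hx with h | h
      · simp [hR x h]
      · simp [hρ x h]
    · rwa [(isCompact_Ann R ρ).isClosed.closure_eq]
  have hFd : ∀ x : E3, ‖x‖ ≠ R → ‖x‖ ≠ ρ → HasFDerivAt F ((Ann R ρ).indicator φ' x) x ∧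
      ‖(Ann R ρ).indicator φ' x‖ ≤ L.toNNReal := by
    intro x h1 h2
    by_cases hx : x ∈ Ann R ρ
    · have h1 : R < ‖x‖ := lt_of_le_of_ne hx.1 (Ne.symm h1)
      have h2 : ‖x‖ < ρ := lt_of_le_of_ne hx.2 h2
      rw [indicator_of_mem hx]
      refine ⟨(hd x h1 h2).1.congr_of_eventuallyEq ?_, (hd x h1 h2).2.trans hLL⟩
      filter_upwards [continuous_norm.continuousAt.eventually (lt_mem_nhds h1),
        continuous_norm.continuousAt.eventually (gt_mem_nhds h2)] with y hy1 hy2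
      exact piecewise_eq_of_mem _ _ _ ⟨le_of_lt hy1, le_of_lt hy2⟩
    · rw [indicator_of_notMem hx]
      refine ⟨(hasFDerivAt_const (0:ℝ) x).congr_of_eventuallyEq ?_, by simp⟩
      filter_upwards [(isCompact_Ann R ρ).isClosed.isOpen_compl.mem_nhds hx] with y hy
      exact piecewise_eq_of_notMem _ _ _ hy
  have hlip : LipschitzWith L.toNNReal F :=
    lipschitzWith_of_hasFDerivAt_off_spheres hFc (R := R) (ρ := ρ)
      (fun x h1 h2 => ⟨_, hFd x h1 h2⟩)
  let b : ContDiffBump (0 : E3) := ⟨|ρ| + 1, |ρ| + 2, by positivity, by linarith⟩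
  have hbR : b.rIn = |ρ| + 1 := rfl
  obtain ⟨D, hD⟩ := ContDiff.lipschitzWith_of_hasCompactSupport (𝕂 := ℝ) b.hasCompactSupport
    (b.contDiff (n := 1)) (by simp)
  have key := hlip.integral_lineDeriv_mul_eq (μ := volume) hD b.hasCompactSupport e
  have hone : ∀ x ∈ Ann R ρ, b =ᶠ[𝓝 x] fun _ => (1:ℝ) := by
    intro x hx
    refine b.eventuallyEq_one_of_mem_ball ?_
    have : ‖x‖ ≤ |ρ| := hx.2.trans (le_abs_self ρ)
    simp [hbR]; linarith
  have hr : ∫ x, lineDeriv ℝ b x (-e) * F x = 0 := by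
    refine integral_eq_zero_of_ae (Filter.Eventually.of_forall fun x => ?_)
    by_cases hx : x ∈ Ann R ρ
    · have : HasFDerivAt b (0 : E3 →L[ℝ] ℝ) x :=
        (hasFDerivAt_const (1:ℝ) x).congr_of_eventuallyEq (hone x hx)
      change lineDeriv ℝ b x (-e) * F x = 0
      rw [(this.hasLineDerivAt (-e)).lineDeriv]
      simp
    · simp [hF, hx]
  rw [hr] at key
  rw [← integral_indicator (measurableSet_Ann R ρ), ← key]
  refine integral_congr_ae ?_
  filter_upwards [ae_norm_ne R, ae_norm_ne ρ] with x h1 h2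
  rw [((hFd x h1 h2).1.hasLineDerivAt e).lineDeriv]
  by_cases hx : x ∈ Ann R ρ
  · simp [hx, (hone x hx).eq_of_nhds]
  · simp [hx]

lemma hasFDerivAt_norm_E3 {x : E3} (hx : x ≠ 0) :
    HasFDerivAt (fun y : E3 => ‖y‖) (‖x‖⁻¹ • innerSL ℝ x) x := by
  have h := (hasStrictFDerivAt_norm_sq x).hasFDerivAt.sqrt (by simpa using hx)
  simp only [Real.sqrt_sq (norm_nonneg _)] at h
  have he : (1 / (2 * ‖x‖)) • 2 • innerSL ℝ x = ‖x‖⁻¹ • innerSL ℝ x := by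
    ext v
    simp
    field_simp
  rwa [he] at h

lemma inner_basis3 (x : E3) (k : Fin 3) : inner ℝ x (basis3 k) = x k := by
  simp [basis3, EuclideanSpace.inner_single_right]

lemma norm_basis3 (k : Fin 3) : ‖basis3 k‖ = 1 := by
  simp [basis3]

lemma cone_mem_nhds {p : E3 × ℝ} (hp : ‖p.1‖ < p.2) : cone ∈ 𝓝 p := by
  have : IsOpen {p : E3 × ℝ | ‖p.1‖ < p.2} :=
    isOpen_lt (continuous_norm.comp continuous_fst) continuous_snd
  filter_upwards [this.mem_nhds hp] with q hq
  exact le_of_lt hq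

lemma uniqueDiffOn_cone : UniqueDiffOn ℝ cone := by
  refine uniqueDiffOn_convex ?_ ⟨(0, 1), mem_interior_iff_mem_nhds.2 (cone_mem_nhds (by simp))⟩
  have : ConvexOn ℝ (univ : Set (E3 × ℝ)) (fun p => ‖p.1‖ - p.2) := by
    refine ConvexOn.sub ?_ ?_
    · exact (convexOn_univ_norm (E := E3)).comp_linearMap (LinearMap.fst ℝ E3 ℝ)
    · exact (LinearMap.snd ℝ E3 ℝ).concaveOn convex_univ
  have he : cone = {p : E3 × ℝ | p ∈ univ ∧ ‖p.1‖ - p.2 ≤ 0} := by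
    ext p
    change ‖p.1‖ ≤ p.2 ↔ p ∈ univ ∧ ‖p.1‖ - p.2 ≤ 0
    simp
  rw [he]
  exact this.convex_le 0

lemma isCompact_Kreg (R T ρ : ℝ) : IsCompact (Kreg R T ρ) := by
  refine ((isCompact_closedBall (0 : E3) ρ).prod
    (isCompact_Icc (a := R) (b := T))).of_isClosed_subset ?_ ?_
  · have hn : Continuous fun p : E3 × ℝ => ‖p.1‖ := by fun_prop
    exact (isClosed_le continuous_const hn).inter ((isClosed_le hn continuous_const).inter
      ((isClosed_le hn continuous_snd).inter
      (isClosed_le continuous_snd (continuous_const.sub hn))))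
  · rintro ⟨x, t⟩ ⟨h1, h2, h3, h4⟩
    simp only at h1 h2 h3 h4
    refine ⟨by simpa using h2, ?_, ?_⟩ <;> simp only <;> linarith

lemma Kreg_subset_cone (R T ρ : ℝ) : Kreg R T ρ ⊆ cone := fun _ hp => hp.2.2.1

lemma setIntegral_Kreg {R T : ℝ} {Φ : E3 × ℝ → ℝ}
    (hΦ : IntegrableOn Φ (Kreg R T ((R + T) / 2))) :
    ∫ p in Kreg R T ((R + T) / 2), Φ p =
      ∫ x in Ann R ((R + T) / 2), ∫ t in ‖x‖..(R + T - ‖x‖), Φ (x, t) := by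
  have hm := (isCompact_Kreg R T ((R + T) / 2)).measurableSet
  rw [← integral_indicator hm, Measure.volume_eq_prod, integral_prod]
  · rw [← integral_indicator (measurableSet_Ann _ _)]
    congr 1
    ext x
    by_cases hx : x ∈ Ann R ((R + T) / 2)
    · have hle : ‖x‖ ≤ R + T - ‖x‖ := by linarith [hx.2]
      rw [indicator_of_mem hx, intervalIntegral.integral_of_le hle, ← integral_Icc_eq_integral_Ioc,
        ← integral_indicator measurableSet_Icc]
      congr 1
      ext t
      by_cases ht : t ∈ Icc ‖x‖ (R + T - ‖x‖)
      · rw [indicator_of_mem ht, indicator_of_mem]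
        exact ⟨hx.1, hx.2, ht.1, ht.2⟩
      · rw [indicator_of_notMem ht, indicator_of_notMem]
        exact fun h => ht ⟨h.2.2.1, h.2.2.2⟩
    · rw [indicator_of_notMem hx]
      rw [← integral_zero ℝ ℝ (μ := volume)]
      congr 1
      ext t
      rw [indicator_of_notMem]
      exact fun h => hx ⟨h.1, h.2.1⟩
  · rw [← Measure.volume_eq_prod]
    exact hΦ.integrable_indicator hm

lemma continuousOn_fderivWithin_cone {f : E3 × ℝ → ℝ} (hf : ContDiffOn ℝ 1 f cone) :
    ContinuousOn (fderivWithin ℝ f cone) cone :=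
  hf.continuousOn_fderivWithin uniqueDiffOn_cone le_rfl

lemma hasFDerivAt_of_contDiffOn_cone {f : E3 × ℝ → ℝ} (hf : ContDiffOn ℝ 1 f cone)
    {p : E3 × ℝ} (hp : ‖p.1‖ < p.2) : HasFDerivAt f (fderivWithin ℝ f cone p) p :=
  (hf.differentiableOn one_ne_zero p (le_of_lt hp)).hasFDerivWithinAt.hasFDerivAt
    (cone_mem_nhds hp)

/-- Fundamental theorem of calculus along a vertical segment in the cone. -/
lemma integral_fderivWithin_time {f : E3 × ℝ → ℝ} (hf : ContDiffOn ℝ 1 f cone) {x : E3} {b : ℝ}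
    (hb : ‖x‖ ≤ b) :
    ∫ t in ‖x‖..b, fderivWithin ℝ f cone (x, t) (0, 1) = f (x, b) - f (x, ‖x‖) := by
  have hmap : MapsTo (fun t : ℝ => (x, t)) (Icc ‖x‖ b) cone := fun t ht => ht.1
  have hc : Continuous (fun t : ℝ => (x, t)) := by fun_prop
  refine intervalIntegral.integral_eq_sub_of_hasDerivAt_of_le (f := fun t => f (x, t)) hb
    (hf.continuousOn.comp hc.continuousOn hmap) ?_ ?_
  · intro t ht
    have h1 : HasDerivAt (fun t : ℝ => (x, t)) ((0 : E3), (1:ℝ)) t :=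
      (hasDerivAt_const t x).prodMk (hasDerivAt_id t)
    exact (hasFDerivAt_of_contDiffOn_cone hf (p := (x, t)) ht.1).comp_hasDerivAt t h1
  · refine ContinuousOn.intervalIntegrable ?_
    rw [uIcc_of_le hb]
    exact ((continuousOn_fderivWithin_cone hf).comp hc.continuousOn hmap).clm_apply
      continuousOn_const

lemma swap_integral_Ann_unitInterval {R ρ : ℝ} {Ψ : E3 × ℝ → ℝ}
    (hΨ : ContinuousOn Ψ (Ann R ρ ×ˢ Icc 0 1)) :
    ∫ x in Ann R ρ, ∫ s in (0:ℝ)..1, Ψ (x, s) = ∫ s in (0:ℝ)..1, ∫ x in Ann R ρ, Ψ (x, s) := by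
  have hi : IntegrableOn Ψ (Ann R ρ ×ˢ Icc 0 1) :=
    hΨ.integrableOn_compact ((isCompact_Ann R ρ).prod isCompact_Icc)
  have hi2 : IntegrableOn Ψ (Ann R ρ ×ˢ Ioc 0 1) :=
    hi.mono_set (prod_mono le_rfl Ioc_subset_Icc_self)
  simp only [intervalIntegral.integral_of_le zero_le_one]
  refine integral_integral_swap (f := fun x s => Ψ (x, s)) ?_
  rw [Measure.prod_restrict]
  exact hi2

/-- The height `|x| + s (R + T - 2|x|)` interpolating between the two boundary cones. -/
def interpHeight (R T s : ℝ) (x : E3) : ℝ := ‖x‖ + (R + T - 2 * ‖x‖) * s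

lemma interpHeight_mem {R T s : ℝ} {x : E3} (hx : x ∈ Ann R ((R + T) / 2)) (hs : s ∈ Icc 0 1) :
    (x, interpHeight R T s x) ∈ Kreg R T ((R + T) / 2) := by
  have h0 : 0 ≤ R + T - 2 * ‖x‖ := by linarith [hx.2]
  refine ⟨hx.1, hx.2, ?_, ?_⟩ <;> simp only [interpHeight]
  · nlinarith [hs.1]
  · nlinarith [hs.2]

/-- The integrand arising from differentiating `(R + T - 2|x|) X(x, interpHeight s x)`. -/
def interpFDeriv (R T s : ℝ) (X : E3 × ℝ → ℝ) (x : E3) : E3 →L[ℝ] ℝ :=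
  (R + T - 2 * ‖x‖) • (fderivWithin ℝ X cone (x, interpHeight R T s x)).comp
    ((ContinuousLinearMap.id ℝ E3).prod ((1 - 2 * s) • (‖x‖⁻¹ • innerSL ℝ x)))
    + X (x, interpHeight R T s x) • ((-2 : ℝ) • (‖x‖⁻¹ • innerSL ℝ x))

lemma interpFDeriv_apply (R T s : ℝ) (X : E3 × ℝ → ℝ) (x : E3) (k : Fin 3) :
    interpFDeriv R T s X x (basis3 k) =
      (R + T - 2 * ‖x‖) * fderivWithin ℝ X cone (x, interpHeight R T s x) (basis3 k, 0)
      + ‖x‖⁻¹ * x k * ((1 - 2 * s) * ((R + T - 2 * ‖x‖) *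
          fderivWithin ℝ X cone (x, interpHeight R T s x) (0, 1))
        - 2 * X (x, interpHeight R T s x)) := by
  set D := fderivWithin ℝ X cone (x, interpHeight R T s x) with hD
  have : D (basis3 k, (1 - 2 * s) * (‖x‖⁻¹ * x k)) =
      D (basis3 k, 0) + ((1 - 2 * s) * (‖x‖⁻¹ * x k)) * D (0, 1) := by
    rw [← smul_eq_mul (a := (1 - 2 * s) * (‖x‖⁻¹ * x k)) (b := D (0, 1)), ← map_smul, ← map_add]
    simp
  simp only [interpFDeriv, add_apply, smul_apply,
    ContinuousLinearMap.comp_apply, ContinuousLinearMap.prod_apply, ContinuousLinearMap.id_apply,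
    innerSL_apply_apply, inner_basis3, smul_eq_mul, ← hD, this]
  ring

lemma hasFDerivAt_interp {R T s : ℝ} (hR : 0 < R) (hs : s ∈ Ioo 0 1) {X : E3 × ℝ → ℝ}
    (hX : ContDiffOn ℝ 1 X cone) {x : E3} (h1 : R < ‖x‖) (h2 : ‖x‖ < (R + T) / 2) :
    HasFDerivAt (fun y => (R + T - 2 * ‖y‖) * X (y, interpHeight R T s y))
      (interpFDeriv R T s X x) x := by
  have hx0 : x ≠ 0 := by
    rintro rfl
    simp at h1
    linarith
  have hm : 0 < R + T - 2 * ‖x‖ := by linarith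
  have hn := hasFDerivAt_norm_E3 hx0
  have hpos : ‖x‖ < interpHeight R T s x := by
    simp only [interpHeight]
    nlinarith [mul_pos hm hs.1]
  have hmf : HasFDerivAt (fun y : E3 => R + T - 2 * ‖y‖) ((-2 : ℝ) • (‖x‖⁻¹ • innerSL ℝ x)) x := by
    refine ((hn.const_mul 2).const_sub (R + T)).congr_fderiv ?_
    rw [neg_smul]
  have hτ : HasFDerivAt (fun y : E3 => interpHeight R T s y)
      ((1 - 2 * s) • (‖x‖⁻¹ • innerSL ℝ x)) x := by
    refine (hn.add (hmf.mul_const s)).congr_fderiv ?_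
    module
  have hp : HasFDerivAt (fun y : E3 => (y, interpHeight R T s y))
      ((ContinuousLinearMap.id ℝ E3).prod ((1 - 2 * s) • (‖x‖⁻¹ • innerSL ℝ x))) x :=
    (hasFDerivAt_id x).prodMk hτ
  have hc := (hasFDerivAt_of_contDiffOn_cone hX (p := (x, interpHeight R T s x)) hpos).comp x hp
  exact hmf.mul hc

lemma norm_inv_smul_innerSL_le (x : E3) : ‖‖x‖⁻¹ • innerSL ℝ x‖ ≤ 1 := by
  rw [norm_smul, norm_inv, norm_norm, innerSL_apply_norm]
  exact inv_mul_le_one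

lemma exists_norm_interpFDeriv_le {R T s : ℝ} (hs : s ∈ Icc 0 1) {X : E3 × ℝ → ℝ}
    (hX : ContDiffOn ℝ 1 X cone) :
    ∃ L : ℝ, ∀ x ∈ Ann R ((R + T) / 2), ‖interpFDeriv R T s X x‖ ≤ L := by
  have hK := isCompact_Kreg R T ((R + T) / 2)
  have hKc := Kreg_subset_cone R T ((R + T) / 2)
  obtain ⟨C1, hC1⟩ := hK.exists_bound_of_continuousOn ((continuousOn_fderivWithin_cone hX).mono hKc)
  obtain ⟨C0, hC0⟩ := hK.exists_bound_of_continuousOn (hX.continuousOn.mono hKc)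
  refine ⟨|R + T - 2 * R| * (C1 * (1 + 1)) + C0 * 2, fun x hx => ?_⟩
  have hp := interpHeight_mem hx hs
  have hN := norm_inv_smul_innerSL_le x
  have hm : |R + T - 2 * ‖x‖| ≤ |R + T - 2 * R| := by
    rw [abs_of_nonneg (by linarith [hx.2])]
    exact le_trans (by linarith [hx.1]) (le_abs_self _)
  have hs1 : |1 - 2 * s| ≤ 1 := abs_le.2 ⟨by linarith [hs.2], by linarith [hs.1]⟩
  have hC1' := (norm_nonneg _).trans (hC1 _ hp)
  have hpr : ‖(ContinuousLinearMap.id ℝ E3).prod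
      ((1 - 2 * s) • (‖x‖⁻¹ • innerSL ℝ x))‖ ≤ 1 + 1 := by
    rw [ContinuousLinearMap.opNorm_prod, Prod.norm_mk]
    refine max_le ?_ ?_
    · exact ContinuousLinearMap.norm_id_le.trans (by norm_num)
    · rw [norm_smul, Real.norm_eq_abs]
      have : |1 - 2 * s| * ‖‖x‖⁻¹ • innerSL ℝ x‖ ≤ 1 * 1 := by gcongr
      linarith
  refine (norm_add_le _ _).trans (add_le_add ?_ ?_)
  · rw [norm_smul, Real.norm_eq_abs]
    refine mul_le_mul hm ?_ (norm_nonneg _) (abs_nonneg _)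
    exact (ContinuousLinearMap.opNorm_comp_le _ _).trans
      (mul_le_mul (hC1 _ hp) hpr (norm_nonneg _) hC1')
  · rw [norm_smul]
    refine mul_le_mul (hC0 _ hp) ?_ (norm_nonneg _) ((norm_nonneg _).trans (hC0 _ hp))
    rw [norm_smul]
    norm_num
    linarith

lemma integral_interpFDeriv_eq_zero {R T s : ℝ} (hR : 0 < R) (hs : s ∈ Ioo 0 1)
    {X : E3 × ℝ → ℝ} (hX : ContDiffOn ℝ 1 X cone) (hRT : R < T)
    (h0 : ∀ x : E3, ‖x‖ = R → ∀ t, R < t → t < T → X (x, t) = 0) (k : Fin 3) :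
    ∫ x in Ann R ((R + T) / 2), interpFDeriv R T s X x (basis3 k) = 0 := by
  have hs' : s ∈ Icc (0:ℝ) 1 := ⟨hs.1.le, hs.2.le⟩
  obtain ⟨L, hL⟩ := exists_norm_interpFDeriv_le (R := R) (T := T) hs' hX
  refine integral_Ann_fderiv_eq_zero (L := L)
    (φ := fun y => (R + T - 2 * ‖y‖) * X (y, interpHeight R T s y)) ?_ ?_ ?_ ?_ _
  · have hc : Continuous fun y : E3 => (y, interpHeight R T s y) := by
      unfold interpHeight
      fun_prop
    refine ContinuousOn.mul (by fun_prop) (hX.continuousOn.comp hc.continuousOn ?_)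
    exact fun y hy => Kreg_subset_cone _ _ _ (interpHeight_mem hy hs')
  · intro x hx
    rw [h0 x hx _ _ _, mul_zero] <;> simp only [interpHeight, hx]
    · nlinarith [mul_pos (sub_pos.2 hRT) hs.1]
    · nlinarith [mul_pos (sub_pos.2 hRT) (sub_pos.2 hs.2)]
  · intro x hx
    simp only [hx]
    ring
  · exact fun x h1 h2 => ⟨hasFDerivAt_interp hR hs hX h1 h2, hL x ⟨h1.le, h2.le⟩⟩

/-- The divergence theorem in one spatial coordinate on the region between the two cones, for
functions vanishing on the lateral boundary. -/
lemma integral_fderivWithin_space {R T : ℝ} (hR : 0 < R) (hRT : R < T)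
    {X : E3 × ℝ → ℝ} (hX : ContDiffOn ℝ 1 X cone)
    (h0 : ∀ x : E3, ‖x‖ = R → ∀ t, R < t → t < T → X (x, t) = 0) (k : Fin 3) :
    ∫ x in Ann R ((R + T) / 2), ∫ t in ‖x‖..(R + T - ‖x‖),
        fderivWithin ℝ X cone (x, t) (basis3 k, 0) =
      ∫ x in Ann R ((R + T) / 2), ‖x‖⁻¹ * x k * (X (x, R + T - ‖x‖) + X (x, ‖x‖)) := by
  set A := Ann R ((R + T) / 2) with hA
  have hx0 : ∀ x ∈ A, ‖x‖ ≠ 0 := fun x hx => (hR.trans_le hx.1).ne'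
  have hDc := continuousOn_fderivWithin_cone hX
  have hcm : Continuous fun q : E3 × ℝ => (q.1, interpHeight R T q.2 q.1) := by
    unfold interpHeight
    fun_prop
  have hmaps : MapsTo (fun q : E3 × ℝ => (q.1, interpHeight R T q.2 q.1)) (A ×ˢ Icc 0 1) cone :=
    fun q hq => Kreg_subset_cone _ _ _ (interpHeight_mem hq.1 hq.2)
  have hcont : ContinuousOn (fun q : E3 × ℝ => interpFDeriv R T q.2 X q.1 (basis3 k))
      (A ×ˢ Icc 0 1) := by
    simp only [interpFDeriv_apply]
    have h1 := (hDc.comp hcm.continuousOn hmaps).clm_apply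
      (continuousOn_const (c := ((basis3 k, 0) : E3 × ℝ)))
    have h2 := (hDc.comp hcm.continuousOn hmaps).clm_apply
      (continuousOn_const (c := ((0, 1) : E3 × ℝ)))
    have h3 := hX.continuousOn.comp hcm.continuousOn hmaps
    have h4 : ContinuousOn (fun q : E3 × ℝ => ‖q.1‖⁻¹) (A ×ˢ Icc 0 1) :=
      ContinuousOn.inv₀ (by fun_prop) fun q hq => hx0 _ hq.1
    have h5 : ContinuousOn (fun q : E3 × ℝ => q.1 k) (A ×ˢ Icc 0 1) := by fun_prop
    have h6 : ContinuousOn (fun q : E3 × ℝ => R + T - 2 * ‖q.1‖) (A ×ˢ Icc 0 1) := by fun_prop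
    have h7 : ContinuousOn (fun q : E3 × ℝ => 1 - 2 * q.2) (A ×ˢ Icc 0 1) := by fun_prop
    exact (h6.mul h1).add ((h4.mul h5).mul ((h7.mul (h6.mul h2)).sub (continuousOn_const.mul h3)))
  have hzero : ∫ x in A, ∫ s in (0:ℝ)..1, interpFDeriv R T s X x (basis3 k) = 0 := by
    have hsw := swap_integral_Ann_unitInterval hcont
    simp only at hsw
    rw [hsw, intervalIntegral.integral_of_le zero_le_one, integral_Ioc_eq_integral_Ioo]
    refine setIntegral_eq_zero_of_forall_eq_zero fun s hs => ?_
    exact integral_interpFDeriv_eq_zero hR hs hX hRT h0 k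
  have hinner : ∀ x ∈ A, ‖x‖ ≠ (R + T) / 2 →
      ∫ s in (0:ℝ)..1, interpFDeriv R T s X x (basis3 k) =
        (∫ t in ‖x‖..(R + T - ‖x‖), fderivWithin ℝ X cone (x, t) (basis3 k, 0))
          - ‖x‖⁻¹ * x k * (X (x, R + T - ‖x‖) + X (x, ‖x‖)) := by
    intro x hx hxne
    have hlt : ‖x‖ < (R + T) / 2 := lt_of_le_of_ne hx.2 hxne
    have hm : 0 < R + T - 2 * ‖x‖ := by linarith
    have hcx : Continuous fun s : ℝ => (x, interpHeight R T s x) := by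
      unfold interpHeight
      fun_prop
    have hmx : MapsTo (fun s : ℝ => (x, interpHeight R T s x)) (Icc 0 1) cone :=
      fun s hs => Kreg_subset_cone _ _ _ (interpHeight_mem hx hs)
    have c1 : ContinuousOn (fun s => fderivWithin ℝ X cone (x, interpHeight R T s x) (basis3 k, 0))
        (Icc 0 1) := (hDc.comp hcx.continuousOn hmx).clm_apply continuousOn_const
    have c2 : ContinuousOn (fun s => fderivWithin ℝ X cone (x, interpHeight R T s x) (0, 1))
        (Icc 0 1) := (hDc.comp hcx.continuousOn hmx).clm_apply continuousOn_const
    have c3 : ContinuousOn (fun s => X (x, interpHeight R T s x)) (Icc 0 1) :=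
      hX.continuousOn.comp hcx.continuousOn hmx
    have hlin : ContinuousOn (fun s : ℝ => 1 - 2 * s) (Icc 0 1) := by fun_prop
    have c4 : ContinuousOn (fun s : ℝ => (1 - 2 * s) * ((R + T - 2 * ‖x‖) *
          fderivWithin ℝ X cone (x, interpHeight R T s x) (0, 1))
        - 2 * X (x, interpHeight R T s x)) (Icc 0 1) :=
      (hlin.mul (continuousOn_const.mul c2)).sub (continuousOn_const.mul c3)
    simp only [interpFDeriv_apply]
    rw [intervalIntegral.integral_add, intervalIntegral.integral_const_mul,
      intervalIntegral.integral_const_mul]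
    · have e1 : (R + T - 2 * ‖x‖) * ∫ s in (0:ℝ)..1,
          fderivWithin ℝ X cone (x, interpHeight R T s x) (basis3 k, 0) =
          ∫ t in ‖x‖..(R + T - ‖x‖), fderivWithin ℝ X cone (x, t) (basis3 k, 0) := by
        have := intervalIntegral.mul_integral_comp_add_mul (a := 0) (b := 1)
          (f := fun t => fderivWithin ℝ X cone (x, t) (basis3 k, 0)) (c := R + T - 2 * ‖x‖)
          (d := ‖x‖)
        simp only [interpHeight]
        rw [this]
        congr 1 <;> ring
      have e2 : ∫ s in (0:ℝ)..1, ((1 - 2 * s) * ((R + T - 2 * ‖x‖) *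
            fderivWithin ℝ X cone (x, interpHeight R T s x) (0, 1))
          - 2 * X (x, interpHeight R T s x)) = - (X (x, R + T - ‖x‖) + X (x, ‖x‖)) := by
        rw [intervalIntegral.integral_eq_sub_of_hasDerivAt_of_le zero_le_one
          (f := fun s => (1 - 2 * s) * X (x, interpHeight R T s x))]
        · simp only [interpHeight]
          ring_nf
        · exact hlin.mul c3
        · intro s hs
          have hpos : ‖x‖ < interpHeight R T s x := by
            simp only [interpHeight]
            nlinarith [mul_pos hm hs.1]
          have d1 : HasDerivAt (fun s : ℝ => interpHeight R T s x) (R + T - 2 * ‖x‖) s := by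
            simpa [interpHeight] using ((hasDerivAt_id s).const_mul (R + T - 2 * ‖x‖)).const_add ‖x‖
          have d2 := (hasFDerivAt_of_contDiffOn_cone hX
            (p := (x, interpHeight R T s x)) hpos).comp_hasDerivAt s
              ((hasDerivAt_const s x).prodMk d1)
          have d3 : HasDerivAt (fun s : ℝ => 1 - 2 * s) (-2) s := by
            simpa using ((hasDerivAt_id s).const_mul 2).const_sub 1
          have d4 := d3.mul d2
          refine d4.congr_deriv ?_
          have : ((0 : E3), R + T - 2 * ‖x‖) = (R + T - 2 * ‖x‖) • ((0 : E3), (1:ℝ)) := by simp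
          rw [this, map_smul, smul_eq_mul]
          simp only [Function.comp]
          ring
        · exact ContinuousOn.intervalIntegrable (by rwa [uIcc_of_le zero_le_one])
      rw [e1, e2]
      ring
    · exact ContinuousOn.intervalIntegrable
        (by rw [uIcc_of_le zero_le_one]; exact continuousOn_const.mul c1)
    · exact ContinuousOn.intervalIntegrable
        (by rw [uIcc_of_le zero_le_one]; exact continuousOn_const.mul c4)
  have hbdry : IntegrableOn (fun x : E3 => ‖x‖⁻¹ * x k * (X (x, R + T - ‖x‖) + X (x, ‖x‖))) A := by
    refine ContinuousOn.integrableOn_compact (isCompact_Ann _ _) ?_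
    have h4 : ContinuousOn (fun x : E3 => ‖x‖⁻¹) A := ContinuousOn.inv₀ (by fun_prop) hx0
    have h5 : ContinuousOn (fun x : E3 => x k) A := by fun_prop
    have ct : Continuous fun x : E3 => (x, R + T - ‖x‖) := by fun_prop
    have cb : Continuous fun x : E3 => (x, ‖x‖) := by fun_prop
    refine (h4.mul h5).mul ((hX.continuousOn.comp ct.continuousOn ?_).add
      (hX.continuousOn.comp cb.continuousOn ?_))
    · intro x hx
      change ‖x‖ ≤ R + T - ‖x‖
      linarith [hx.2]
    · intro x _
      exact le_refl ‖x‖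
  have hae : ∀ᵐ x ∂(volume.restrict A), (∫ s in (0:ℝ)..1, interpFDeriv R T s X x (basis3 k)) +
      ‖x‖⁻¹ * x k * (X (x, R + T - ‖x‖) + X (x, ‖x‖)) =
      ∫ t in ‖x‖..(R + T - ‖x‖), fderivWithin ℝ X cone (x, t) (basis3 k, 0) := by
    filter_upwards [ae_restrict_mem (measurableSet_Ann R ((R + T) / 2)),
      ae_restrict_of_ae (ae_norm_ne ((R + T) / 2))] with x hx hne
    rw [hinner x hx hne]
    ring
  rw [← integral_congr_ae hae, integral_add _ hbdry, hzero, zero_add]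
  have hi : IntegrableOn (fun q : E3 × ℝ => interpFDeriv R T q.2 X q.1 (basis3 k))
      (A ×ˢ Ioc 0 1) :=
    (hcont.integrableOn_compact ((isCompact_Ann _ _).prod isCompact_Icc)).mono_set
        (prod_mono le_rfl Ioc_subset_Icc_self)
  simp only [intervalIntegral.integral_of_le zero_le_one]
  rw [IntegrableOn, Measure.volume_eq_prod, ← Measure.prod_restrict] at hi
  exact hi.integral_prod_left

lemma ae_norm_fst_ne_snd : ∀ᵐ p : E3 × ℝ, ‖p.1‖ ≠ p.2 := by
  have hm : MeasurableSet {p : E3 × ℝ | ‖p.1‖ = p.2} :=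
    measurableSet_eq_fun (by fun_prop) (by fun_prop)
  have h0 : (volume : Measure (E3 × ℝ)) {p : E3 × ℝ | ‖p.1‖ = p.2} = 0 := by
    rw [Measure.volume_eq_prod, Measure.measure_prod_null hm]
    refine Eventually.of_forall fun x => ?_
    have : (Prod.mk x ⁻¹' {p : E3 × ℝ | ‖p.1‖ = p.2}) = {‖x‖} := by
      ext t
      exact eq_comm
    simp [this]
  filter_upwards [measure_eq_zero_iff_ae_notMem.1 h0] with p hp using hp

lemma ae_Kreg_interior (R T ρ : ℝ) :
    ∀ᵐ p ∂(volume.restrict (Kreg R T ρ)), p ∈ Kreg R T ρ ∧ ‖p.1‖ < p.2 := by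
  filter_upwards [ae_restrict_mem (isCompact_Kreg R T ρ).measurableSet,
    ae_restrict_of_ae ae_norm_fst_ne_snd] with p hp hne
  exact ⟨hp, lt_of_le_of_ne hp.2.2.1 hne⟩

lemma contDiffOn_fderivWithin_cone_apply {z : E3 × ℝ → ℝ} (hz : ContDiffOn ℝ 2 z cone)
    (e : E3 × ℝ) : ContDiffOn ℝ 1 (fun p => fderivWithin ℝ z cone p e) cone :=
  (hz.fderivWithin uniqueDiffOn_cone (by norm_num)).clm_apply contDiffOn_const

lemma fderiv_fixT {f : E3 × ℝ → ℝ} {D : E3 × ℝ →L[ℝ] ℝ} {p : E3 × ℝ} (h : HasFDerivAt f D p)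
    (v : E3) : fderiv ℝ (fixT f p.2) p.1 v = D (v, 0) := by
  have h1 : HasFDerivAt (fun y : E3 => (y, p.2))
      ((ContinuousLinearMap.id ℝ E3).prod (0 : E3 →L[ℝ] ℝ)) p.1 :=
    (hasFDerivAt_id p.1).prodMk (hasFDerivAt_const p.2 p.1)
  have h2 : HasFDerivAt (fixT f p.2) _ p.1 := HasFDerivAt.comp (g := f) p.1 h h1
  rw [h2.fderiv]
  simp

lemma eventually_interior_cone {p : E3 × ℝ} (hp : ‖p.1‖ < p.2) :
    ∀ᶠ q : E3 × ℝ in 𝓝 p, ‖q.1‖ < q.2 :=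
  (isOpen_lt (by fun_prop) (by fun_prop)).mem_nhds (show p ∈ {q : E3 × ℝ | ‖q.1‖ < q.2} from hp)

lemma pdt_eq_fderivWithin {f : E3 × ℝ → ℝ} (hf : ContDiffOn ℝ 1 f cone) {p : E3 × ℝ}
    (hp : ‖p.1‖ < p.2) : pdt f p = fderivWithin ℝ f cone p (0, 1) := by
  rw [pdt, (hasFDerivAt_of_contDiffOn_cone hf hp).fderiv]

lemma pdx_eq_fderivWithin {f : E3 × ℝ → ℝ} (hf : ContDiffOn ℝ 1 f cone) {p : E3 × ℝ}
    (hp : ‖p.1‖ < p.2) (k : Fin 3) : pdx k f p = fderivWithin ℝ f cone p (basis3 k, 0) := by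
  rw [pdx, pd, fderiv_fixT (hasFDerivAt_of_contDiffOn_cone hf hp)]

lemma pdt_pdt_eq_fderivWithin {z : E3 × ℝ → ℝ} (hz : ContDiffOn ℝ 2 z cone) {p : E3 × ℝ}
    (hp : ‖p.1‖ < p.2) : pdt (pdt z) p =
      fderivWithin ℝ (fun r => fderivWithin ℝ z cone r (0, 1)) cone p (0, 1) := by
  have hz1 : ContDiffOn ℝ 1 z cone := hz.of_le (by norm_num)
  have h : pdt z =ᶠ[𝓝 p] fun r => fderivWithin ℝ z cone r (0, 1) := by
    filter_upwards [eventually_interior_cone hp] with r hr using pdt_eq_fderivWithin hz1 hr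
  rw [← pdt_eq_fderivWithin (contDiffOn_fderivWithin_cone_apply hz (0, 1)) hp]
  exact congrArg (fun D : E3 × ℝ →L[ℝ] ℝ => D (0, 1)) h.fderiv_eq

lemma pd_pd_fixT_eq_fderivWithin {z : E3 × ℝ → ℝ} (hz : ContDiffOn ℝ 2 z cone) (k : Fin 3)
    {x : E3} {t : ℝ} (hp : ‖x‖ < t) : pd k (pd k (fixT z t)) x =
      fderivWithin ℝ (fun r => fderivWithin ℝ z cone r (basis3 k, 0)) cone (x, t)
        (basis3 k, 0) := by
  have hz1 : ContDiffOn ℝ 1 z cone := hz.of_le (by norm_num)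
  have hc : ∀ᶠ y : E3 in 𝓝 x, ‖y‖ < t :=
    continuous_norm.continuousAt.eventually_lt continuousAt_const hp
  have h : pd k (fixT z t) =ᶠ[𝓝 x]
      fixT (fun r => fderivWithin ℝ z cone r (basis3 k, 0)) t := by
    filter_upwards [hc] with y hy
    exact pdx_eq_fderivWithin hz1 (p := (y, t)) hy k
  have h2 := pdx_eq_fderivWithin (contDiffOn_fderivWithin_cone_apply hz (basis3 k, 0))
    (p := (x, t)) hp k
  rw [← h2, pd, h.fderiv_eq]
  rfl

lemma lapX_eq_fderivWithin {z : E3 × ℝ → ℝ} (hz : ContDiffOn ℝ 2 z cone) {p : E3 × ℝ}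
    (hp : ‖p.1‖ < p.2) : lapX z p =
      ∑ k, fderivWithin ℝ (fun r => fderivWithin ℝ z cone r (basis3 k, 0)) cone p
        (basis3 k, 0) := by
  obtain ⟨x, t⟩ := p
  rw [lapX, lap]
  exact Finset.sum_congr rfl fun k _ => pd_pd_fixT_eq_fderivWithin hz k hp

lemma fderivWithin_cone_symm {z : E3 × ℝ → ℝ} (hz : ContDiffOn ℝ 2 z cone) {p : E3 × ℝ}
    (hp : ‖p.1‖ < p.2) (v w : E3 × ℝ) :
    fderivWithin ℝ (fun r => fderivWithin ℝ z cone r v) cone p w =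
      fderivWithin ℝ (fun r => fderivWithin ℝ z cone r w) cone p v := by
  have hz1 : ContDiffOn ℝ 1 z cone := hz.of_le (by norm_num)
  have hat : ContDiffAt ℝ 2 z p := hz.contDiffAt (cone_mem_nhds hp)
  have hs : IsSymmSndFDerivAt ℝ z p := hat.isSymmSndFDerivAt (by simp)
  have hd : DifferentiableAt ℝ (fderiv ℝ z) p :=
    (hat.fderiv_right (m := 1) (by norm_num)).differentiableAt one_ne_zero
  have key : ∀ v w : E3 × ℝ, fderivWithin ℝ (fun r => fderivWithin ℝ z cone r v) cone p w =
      fderiv ℝ (fderiv ℝ z) p w v := by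
    intro v w
    have h1 : HasFDerivAt (fun r => fderiv ℝ z r v) ((fderiv ℝ (fderiv ℝ z) p).flip v) p :=
      (hd.hasFDerivAt.clm_apply (hasFDerivAt_const v p)).congr_fderiv (by ext <;> simp)
    have h2 : (fun r => fderivWithin ℝ z cone r v) =ᶠ[𝓝 p] fun r => fderiv ℝ z r v := by
      filter_upwards [eventually_interior_cone hp] with r hr
      rw [(hasFDerivAt_of_contDiffOn_cone hz1 hr).fderiv]
    rw [fderivWithin_of_mem_nhds (cone_mem_nhds hp), (h1.congr_of_eventuallyEq h2).fderiv]
    rfl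
  rw [key, key, hs]

lemma hasFDerivAt_trace {z : E3 × ℝ → ℝ} (hz : ContDiffOn ℝ 1 z cone) {x : E3} (hx : x ≠ 0) :
    HasFDerivAt (fun y : E3 => z (y, ‖y‖)) ((fderivWithin ℝ z cone (x, ‖x‖)).comp
      ((ContinuousLinearMap.id ℝ E3).prod (‖x‖⁻¹ • innerSL ℝ x))) x := by
  have h1 : HasFDerivAt (fun y : E3 => (y, ‖y‖))
      ((ContinuousLinearMap.id ℝ E3).prod (‖x‖⁻¹ • innerSL ℝ x)) x :=
    (hasFDerivAt_id x).prodMk (hasFDerivAt_norm_E3 hx)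
  have h2 : HasFDerivWithinAt z (fderivWithin ℝ z cone (x, ‖x‖)) cone (x, ‖x‖) :=
    (hz.differentiableOn one_ne_zero (x, ‖x‖) (le_refl ‖x‖)).hasFDerivWithinAt
  rw [← hasFDerivWithinAt_univ] at h1 ⊢
  exact HasFDerivWithinAt.comp (g := z) x h2 h1 fun y _ => le_refl ‖y‖

lemma pd_trace {z : E3 × ℝ → ℝ} (hz : ContDiffOn ℝ 1 z cone) {x : E3} (hx : x ≠ 0) (k : Fin 3) :
    pd k (fun y : E3 => z (y, ‖y‖)) x = fderivWithin ℝ z cone (x, ‖x‖) (basis3 k, 0) +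
      ‖x‖⁻¹ * x k * fderivWithin ℝ z cone (x, ‖x‖) (0, 1) := by
  rw [pd, (hasFDerivAt_trace hz hx).fderiv]
  set D := fderivWithin ℝ z cone (x, ‖x‖)
  simp only [ContinuousLinearMap.comp_apply, ContinuousLinearMap.prod_apply,
    ContinuousLinearMap.id_apply, smul_apply, innerSL_apply_apply, inner_basis3,
    smul_eq_mul]
  rw [← smul_eq_mul (a := ‖x‖⁻¹ * x k) (b := D (0, 1)), ← map_smul, ← map_add]
  simp

lemma sum_sq_normalized {x : E3} (hx : x ≠ 0) :
    (‖x‖⁻¹ * x 0) ^ 2 + (‖x‖⁻¹ * x 1) ^ 2 + (‖x‖⁻¹ * x 2) ^ 2 = 1 := by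
  have h : ‖x‖ ^ 2 = x 0 ^ 2 + x 1 ^ 2 + x 2 ^ 2 := by
    rw [EuclideanSpace.real_norm_sq_eq, Fin.sum_univ_three]
  have hx' : ‖x‖ ≠ 0 := norm_ne_zero_iff.2 hx
  field_simp
  linarith

lemma hasFDerivAt_exp_time (l : ℝ) (p : E3 × ℝ) :
    HasFDerivAt (fun r : E3 × ℝ => exp (-l * r.2))
      (exp (-l * p.2) • (-l) • ContinuousLinearMap.snd ℝ E3 ℝ) p :=
  ((hasFDerivAt_snd (p := p)).const_mul (-l)).exp

lemma setIntegral_Kreg_fderivWithin_time {R T : ℝ} {f : E3 × ℝ → ℝ}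
    (hf : ContDiffOn ℝ 1 f cone) :
    ∫ p in Kreg R T ((R + T) / 2), fderivWithin ℝ f cone p (0, 1) =
      ∫ x in Ann R ((R + T) / 2), (f (x, R + T - ‖x‖) - f (x, ‖x‖)) := by
  have hc : ContinuousOn (fun p => fderivWithin ℝ f cone p (0, 1)) (Kreg R T ((R + T) / 2)) :=
    ((continuousOn_fderivWithin_cone hf).clm_apply continuousOn_const).mono
      (Kreg_subset_cone R T _)
  rw [setIntegral_Kreg (hc.integrableOn_compact (isCompact_Kreg R T _))]
  refine setIntegral_congr_fun (measurableSet_Ann R _) fun x hx => ?_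
  exact integral_fderivWithin_time hf (by have := hx.2; linarith)

lemma setIntegral_Kreg_fderivWithin_space {R T : ℝ} (hR : 0 < R) (hRT : R < T)
    {X : E3 × ℝ → ℝ} (hX : ContDiffOn ℝ 1 X cone)
    (h0 : ∀ x : E3, ‖x‖ = R → ∀ t, R < t → t < T → X (x, t) = 0) (k : Fin 3) :
    ∫ p in Kreg R T ((R + T) / 2), fderivWithin ℝ X cone p (basis3 k, 0) =
      ∫ x in Ann R ((R + T) / 2), ‖x‖⁻¹ * x k * (X (x, R + T - ‖x‖) + X (x, ‖x‖)) := by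
  have hc : ContinuousOn (fun p => fderivWithin ℝ X cone p (basis3 k, 0))
      (Kreg R T ((R + T) / 2)) :=
    ((continuousOn_fderivWithin_cone hX).clm_apply continuousOn_const).mono
      (Kreg_subset_cone R T _)
  rw [setIntegral_Kreg (hc.integrableOn_compact (isCompact_Kreg R T _))]
  exact integral_fderivWithin_space hR hRT hX h0 k

lemma ne_zero_of_mem_Ann {R ρ : ℝ} (hR : 0 < R) {x : E3} (hx : x ∈ Ann R ρ) : x ≠ 0 :=
  norm_pos_iff.1 (hR.trans_le hx.1)

lemma continuousOn_bottom {R ρ : ℝ} {f : E3 × ℝ → ℝ} (hf : ContinuousOn f cone) :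
    ContinuousOn (fun x : E3 => f (x, ‖x‖)) (Ann R ρ) :=
  hf.comp (by fun_prop) fun x _ => le_refl ‖x‖

lemma continuousOn_top {R T : ℝ} {f : E3 × ℝ → ℝ} (hf : ContinuousOn f cone) :
    ContinuousOn (fun x : E3 => f (x, R + T - ‖x‖)) (Ann R ((R + T) / 2)) :=
  hf.comp (by fun_prop) fun x hx => by
    have := hx.2
    change ‖x‖ ≤ R + T - ‖x‖
    linarith

lemma multiplier_le {a s z G q w M : ℝ} (hw0 : 0 ≤ w) (hw1 : w ≤ 1) (hq : |q| ≤ M)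
    (hs : 0 ≤ s) :
    w * (2 * a * (q * z + G) + 2 * z * a) - (3 + 2 * M ^ 2) * w * (a ^ 2 + s + z ^ 2) ≤
      -(w * (a ^ 2 + s + z ^ 2)) + 2 * G ^ 2 := by
  have hq2 : q ^ 2 ≤ M ^ 2 := sq_le_sq' (abs_le.1 hq).1 (abs_le.1 hq).2
  have hF : (q * z + G) ^ 2 ≤ 2 * M ^ 2 * z ^ 2 + 2 * G ^ 2 := by
    nlinarith [sq_nonneg (q * z - G), mul_le_mul_of_nonneg_right hq2 (sq_nonneg z)]
  have h : 2 * a * (q * z + G) + 2 * z * a - (3 + 2 * M ^ 2) * (a ^ 2 + s + z ^ 2) ≤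
      -(a ^ 2 + s + z ^ 2) + 2 * G ^ 2 := by
    nlinarith [sq_nonneg (a - (q * z + G)), sq_nonneg (z - a), mul_nonneg (sq_nonneg M) hs,
      mul_nonneg (sq_nonneg M) (sq_nonneg a), sq_nonneg a, sq_nonneg z]
  nlinarith [mul_le_mul_of_nonneg_left h hw0, mul_le_mul_of_nonneg_right hw1 (sq_nonneg G)]

lemma top_flux_nonneg {a b0 b1 b2 z n0 n1 n2 : ℝ} (hn : n0 ^ 2 + n1 ^ 2 + n2 ^ 2 = 1) :
    0 ≤ a ^ 2 + (b0 ^ 2 + b1 ^ 2 + b2 ^ 2) + z ^ 2 -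
      (n0 * (2 * (a * b0)) + n1 * (2 * (a * b1)) + n2 * (2 * (a * b2))) := by
  have h : a ^ 2 = a ^ 2 * (n0 ^ 2 + n1 ^ 2 + n2 ^ 2) := by rw [hn, mul_one]
  nlinarith [sq_nonneg (b0 - a * n0), sq_nonneg (b1 - a * n1), sq_nonneg (b2 - a * n2),
    sq_nonneg z]

lemma bottom_flux_eq {a b0 b1 b2 z n0 n1 n2 : ℝ} (hn : n0 ^ 2 + n1 ^ 2 + n2 ^ 2 = 1) :
    z ^ 2 + ((b0 + n0 * a) ^ 2 + (b1 + n1 * a) ^ 2 + (b2 + n2 * a) ^ 2) =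
      a ^ 2 + (b0 ^ 2 + b1 ^ 2 + b2 ^ 2) + z ^ 2 +
      (n0 * (2 * (a * b0)) + n1 * (2 * (a * b1)) + n2 * (2 * (a * b2))) := by
  linear_combination a ^ 2 * hn

lemma bottom_flux_nonneg {a b0 b1 b2 z n0 n1 n2 : ℝ} :
    0 ≤ z ^ 2 + ((b0 + n0 * a) ^ 2 + (b1 + n1 * a) ^ 2 + (b2 + n2 * a) ^ 2) := by
  positivity

lemma integral_sub_add_three {α : Type*} [MeasurableSpace α] {μ : Measure α}
    {f g₀ g₁ g₂ : α → ℝ} (hf : Integrable f μ) (h₀ : Integrable g₀ μ) (h₁ : Integrable g₁ μ)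
    (h₂ : Integrable g₂ μ) :
    (∫ x, f x ∂μ) - ((∫ x, g₀ x ∂μ) + (∫ x, g₁ x ∂μ) + ∫ x, g₂ x ∂μ) =
      ∫ x, (f x - (g₀ x + g₁ x + g₂ x)) ∂μ := by
  have h01 : Integrable (fun x => g₀ x + g₁ x) μ := h₀.add h₁
  have h012 : Integrable (fun x => g₀ x + g₁ x + g₂ x) μ := h01.add h₂
  rw [integral_sub hf h012, integral_add h01 h₂, integral_add h₀ h₁]

/-- Energy multiplier inequality: the weighted energy on `Kreg` is controlled by its flux through
the characteristic boundary `t = |x|`, when the lateral boundary data vanish. -/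
theorem energy_Kreg {R T M : ℝ} (hR : 0 < R) (hRT : R < T)
    {z G : E3 × ℝ → ℝ} {q : E3 → ℝ} (hz : ContDiffOn ℝ 2 z cone)
    (hside : ∀ x : E3, ‖x‖ = R → ∀ t, R < t → t < T → z (x, t) = 0)
    (hq : ∀ x ∈ Ann R ((R + T) / 2), |q x| ≤ M)
    (hG : ContinuousOn G (Kreg R T ((R + T) / 2)))
    (heq : ∀ p ∈ Kreg R T ((R + T) / 2), ‖p.1‖ < p.2 →
      pdt (pdt z) p - lapX z p = q p.1 * z p + G p) :
    ∫ p in Kreg R T ((R + T) / 2), (z p ^ 2 + ∑ k, (fderivWithin ℝ z cone p (basis3 k, 0)) ^ 2) ≤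
      exp ((3 + 2 * M ^ 2) * T) *
        ((∫ x in Ann R ((R + T) / 2), (z (x, ‖x‖) ^ 2 + gradsq (fun y => z (y, ‖y‖)) x))
          + 2 * ∫ p in Kreg R T ((R + T) / 2), G p ^ 2) := by
  set ρ := (R + T) / 2 with hρ
  set K := Kreg R T ρ with hK
  have hKc : IsCompact K := isCompact_Kreg R T ρ
  have hKm : MeasurableSet K := hKc.measurableSet
  have hKs : K ⊆ cone := Kreg_subset_cone R T ρ
  have hAc : IsCompact (Ann R ρ) := isCompact_Ann R ρ
  have hz1 : ContDiffOn ℝ 1 z cone := hz.of_le (by norm_num)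
  set l : ℝ := 3 + 2 * M ^ 2 with hl
  have hl0 : 0 < l := by positivity
  set a : E3 × ℝ → ℝ := fun p => fderivWithin ℝ z cone p (0, 1) with ha
  set b : Fin 3 → E3 × ℝ → ℝ := fun k p => fderivWithin ℝ z cone p (basis3 k, 0) with hb
  set w : E3 × ℝ → ℝ := fun p => exp (-l * p.2) with hw
  have haC : ContDiffOn ℝ 1 a cone := contDiffOn_fderivWithin_cone_apply hz _
  have hbC : ∀ k, ContDiffOn ℝ 1 (b k) cone := fun k => contDiffOn_fderivWithin_cone_apply hz _
  have hwC : ContDiffOn ℝ 1 w cone :=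
    (contDiff_exp.comp (contDiff_const.mul contDiff_snd)).contDiffOn
  set En : E3 × ℝ → ℝ := fun p => a p ^ 2 + (b 0 p ^ 2 + b 1 p ^ 2 + b 2 p ^ 2) + z p ^ 2 with hEn
  have hEnC : ContDiffOn ℝ 1 En cone :=
    ((haC.pow 2).add ((((hbC 0).pow 2).add ((hbC 1).pow 2)).add ((hbC 2).pow 2))).add (hz1.pow 2)
  set f : E3 × ℝ → ℝ := fun p => w p * En p with hf
  set X : Fin 3 → E3 × ℝ → ℝ := fun k p => w p * (2 * (a p * b k p)) with hX
  have hfC : ContDiffOn ℝ 1 f cone := hwC.mul hEnC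
  have hXC : ∀ k, ContDiffOn ℝ 1 (X k) cone := fun k =>
    hwC.mul (contDiffOn_const.mul (haC.mul (hbC k)))
  have hXside : ∀ k, ∀ x : E3, ‖x‖ = R → ∀ t, R < t → t < T → X k (x, t) = 0 := by
    intro k x hx t ht1 ht2
    have hp : ‖x‖ < t := by rwa [hx]
    have h1 : HasFDerivAt z (fderivWithin ℝ z cone (x, t)) (x, t) :=
      hasFDerivAt_of_contDiffOn_cone hz1 (p := (x, t)) hp
    have h2 : HasDerivAt (fun s : ℝ => (x, s)) ((0 : E3), (1 : ℝ)) t :=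
      (hasDerivAt_const t x).prodMk (hasDerivAt_id t)
    have h3 : HasDerivAt (fun s : ℝ => z (x, s)) (a (x, t)) t := h1.comp_hasDerivAt t h2
    have h4 : (fun s : ℝ => z (x, s)) =ᶠ[𝓝 t] fun _ => 0 := by
      filter_upwards [Ioo_mem_nhds ht1 ht2] with s hs using hside x hx s hs.1 hs.2
    have h5 : a (x, t) = 0 := by rw [← h3.deriv, h4.deriv_eq, deriv_const]
    simp [hX, h5]
  have hmul : ∀ p ∈ K, ‖p.1‖ < p.2 →
      fderivWithin ℝ f cone p (0, 1) - (fderivWithin ℝ (X 0) cone p (basis3 0, 0) +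
        fderivWithin ℝ (X 1) cone p (basis3 1, 0) + fderivWithin ℝ (X 2) cone p (basis3 2, 0))
      ≤ - (w p * En p) + 2 * G p ^ 2 := by
    intro p hpK hp
    have hda := hasFDerivAt_of_contDiffOn_cone haC hp
    have hdb := fun k => hasFDerivAt_of_contDiffOn_cone (hbC k) hp
    have hdz := hasFDerivAt_of_contDiffOn_cone hz1 hp
    have hdw : HasFDerivAt w _ p := hasFDerivAt_exp_time l p
    have hdE : HasFDerivAt En _ p :=
      ((hda.pow 2).add ((((hdb 0).pow 2).add ((hdb 1).pow 2)).add ((hdb 2).pow 2))).add (hdz.pow 2)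
    have hdf : HasFDerivAt f _ p := hdw.mul hdE
    have hdX : ∀ k, HasFDerivAt (X k) _ p := fun k =>
      hdw.mul ((hda.mul (hdb k)).const_mul 2)
    have hsym : ∀ k, fderivWithin ℝ (b k) cone p (0, 1) =
        fderivWithin ℝ a cone p (basis3 k, 0) := fun k => fderivWithin_cone_symm hz hp _ _
    have hpde := heq p hpK hp
    rw [pdt_pdt_eq_fderivWithin hz hp, lapX_eq_fderivWithin hz hp, Fin.sum_univ_three] at hpde
    change fderivWithin ℝ a cone p (0, 1) - (fderivWithin ℝ (b 0) cone p (basis3 0, 0) +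
      fderivWithin ℝ (b 1) cone p (basis3 1, 0) + fderivWithin ℝ (b 2) cone p (basis3 2, 0)) = _
      at hpde
    simp only [fderivWithin_of_mem_nhds (cone_mem_nhds hp), hdf.fderiv, (hdX _).fderiv]
    simp only [fderivWithin_of_mem_nhds (cone_mem_nhds hp)] at hpde hsym
    simp only [add_apply, smul_apply, smul_eq_mul, ContinuousLinearMap.coe_snd', hsym]
    have hza : fderiv ℝ z p (0, 1) = a p := congrArg (fun D : E3 × ℝ →L[ℝ] ℝ => D (0, 1)) hdz.fderiv
    have hwp : rexp (-l * p.2) = w p := rfl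
    have hp2 : 0 ≤ p.2 := (norm_nonneg _).trans hp.le
    have hw1 : w p ≤ 1 := exp_le_one_iff.2 (by nlinarith)
    have hm := multiplier_le (a := a p) (z := z p) (G := G p) (exp_pos (-l * p.2)).le hw1
      (hq p.1 ⟨hpK.1, hpK.2.1⟩)
      (s := b 0 p ^ 2 + b 1 p ^ 2 + b 2 p ^ 2) (by positivity)
    rw [hza, hwp]
    rw [hwp, ← hpde] at hm
    refine le_trans (le_of_eq ?_) hm
    simp only [hEn, hl]
    norm_num
    ring
  have hfint : ∀ {g : E3 × ℝ → ℝ}, ContinuousOn g cone → IntegrableOn g K := fun hg =>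
    (hg.mono hKs).integrableOn_compact hKc
  have hDint : ∀ {g : E3 × ℝ → ℝ} (e : E3 × ℝ), ContDiffOn ℝ 1 g cone →
      IntegrableOn (fun p => fderivWithin ℝ g cone p e) K := fun e hg =>
    hfint ((continuousOn_fderivWithin_cone hg).clm_apply continuousOn_const)
  have hG2 : IntegrableOn (fun p => G p ^ 2) K := (hG.pow 2).integrableOn_compact hKc
  have hwEint : IntegrableOn f K := hfint hfC.continuousOn
  have hnegf : IntegrableOn (fun p => -f p) K := hwEint.neg
  have hK1 : (∫ p in K, fderivWithin ℝ f cone p (0, 1)) -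
      ((∫ p in K, fderivWithin ℝ (X 0) cone p (basis3 0, 0)) +
        (∫ p in K, fderivWithin ℝ (X 1) cone p (basis3 1, 0)) +
        ∫ p in K, fderivWithin ℝ (X 2) cone p (basis3 2, 0)) ≤
      -(∫ p in K, f p) + 2 * ∫ p in K, G p ^ 2 := by
    rw [integral_sub_add_three (hDint _ hfC) (hDint _ (hXC 0)) (hDint _ (hXC 1))
        (hDint _ (hXC 2)),
      ← integral_neg, ← integral_const_mul, ← integral_add hnegf (hG2.const_mul 2)]
    refine integral_mono_ae ((hDint _ hfC).sub
        (((hDint _ (hXC 0)).add (hDint _ (hXC 1))).add (hDint _ (hXC 2))))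
      (hwEint.neg.add (hG2.const_mul 2)) ?_
    filter_upwards [ae_Kreg_interior R T ρ] with p hp using hmul p hp.1 hp.2
  have hAint : ∀ {g : E3 → ℝ}, ContinuousOn g (Ann R ρ) → IntegrableOn g (Ann R ρ) := fun hg =>
    hg.integrableOn_compact hAc
  have hbot : ∀ {g : E3 × ℝ → ℝ}, ContDiffOn ℝ 1 g cone →
      ContinuousOn (fun x : E3 => g (x, ‖x‖)) (Ann R ρ) := fun hg =>
    continuousOn_bottom hg.continuousOn
  have htop : ∀ {g : E3 × ℝ → ℝ}, ContDiffOn ℝ 1 g cone →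
      ContinuousOn (fun x : E3 => g (x, R + T - ‖x‖)) (Ann R ρ) := fun hg =>
    continuousOn_top hg.continuousOn
  have hνc : ∀ k : Fin 3, ContinuousOn (fun x : E3 => ‖x‖⁻¹ * x k) (Ann R ρ) := fun k =>
    (continuousOn_id.norm.inv₀ fun x hx => norm_ne_zero_iff.2 (ne_zero_of_mem_Ann hR hx)).mul
      (by fun_prop)
  have hflux : ∀ k, ContinuousOn (fun x : E3 => ‖x‖⁻¹ * x k *
      (X k (x, R + T - ‖x‖) + X k (x, ‖x‖))) (Ann R ρ) := fun k =>
    (hνc k).mul ((htop (hXC k)).add (hbot (hXC k)))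
  have hgrad : ∀ x ∈ Ann R ρ, gradsq (fun y => z (y, ‖y‖)) x =
      (b 0 (x, ‖x‖) + ‖x‖⁻¹ * x 0 * a (x, ‖x‖)) ^ 2 +
      (b 1 (x, ‖x‖) + ‖x‖⁻¹ * x 1 * a (x, ‖x‖)) ^ 2 +
      (b 2 (x, ‖x‖) + ‖x‖⁻¹ * x 2 * a (x, ‖x‖)) ^ 2 := by
    intro x hx
    simp only [gradsq, Fin.sum_univ_three, pd_trace hz1 (ne_zero_of_mem_Ann hR hx), ha, hb]
  have hPc : ContinuousOn (fun x => z (x, ‖x‖) ^ 2 + gradsq (fun y => z (y, ‖y‖)) x)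
      (Ann R ρ) := by
    refine ((hbot hz1).pow 2).add (ContinuousOn.congr ?_ hgrad)
    exact ((((hbot (hbC 0)).add ((hνc 0).mul (hbot haC))).pow 2).add
      (((hbot (hbC 1)).add ((hνc 1).mul (hbot haC))).pow 2)).add
      (((hbot (hbC 2)).add ((hνc 2).mul (hbot haC))).pow 2)
  have hTB : IntegrableOn (fun x : E3 => f (x, R + T - ‖x‖) - f (x, ‖x‖)) (Ann R ρ) :=
    hAint ((htop hfC).sub (hbot hfC))
  have hA1 : -(∫ x in Ann R ρ, (z (x, ‖x‖) ^ 2 + gradsq (fun y => z (y, ‖y‖)) x)) ≤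
      (∫ p in K, fderivWithin ℝ f cone p (0, 1)) -
      ((∫ p in K, fderivWithin ℝ (X 0) cone p (basis3 0, 0)) +
        (∫ p in K, fderivWithin ℝ (X 1) cone p (basis3 1, 0)) +
        ∫ p in K, fderivWithin ℝ (X 2) cone p (basis3 2, 0)) := by
    rw [setIntegral_Kreg_fderivWithin_time hfC,
      setIntegral_Kreg_fderivWithin_space hR hRT (hXC 0) (hXside 0),
      setIntegral_Kreg_fderivWithin_space hR hRT (hXC 1) (hXside 1),
      setIntegral_Kreg_fderivWithin_space hR hRT (hXC 2) (hXside 2),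
      integral_sub_add_three hTB (hAint (hflux 0))
        (hAint (hflux 1)) (hAint (hflux 2)),
      ← integral_neg]
    refine setIntegral_mono_on (hAint hPc).neg
      (hTB.sub
        (((hAint (hflux 0)).add (hAint (hflux 1))).add (hAint (hflux 2))))
      (measurableSet_Ann R ρ) fun x hx => ?_
    have hx0 := ne_zero_of_mem_Ann hR hx
    rw [hgrad x hx]
    have hxn : 0 ≤ ‖x‖ := norm_nonneg x
    have hxt : 0 ≤ w (x, R + T - ‖x‖) := (exp_pos _).le
    have hxb : 0 ≤ w (x, ‖x‖) := (exp_pos _).le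
    have hxb1 : w (x, ‖x‖) ≤ 1 := exp_le_one_iff.2 (by simp only; nlinarith)
    have hν := sum_sq_normalized hx0
    have h1 := mul_nonneg hxt (top_flux_nonneg (a := a (x, R + T - ‖x‖))
      (b0 := b 0 (x, R + T - ‖x‖)) (b1 := b 1 (x, R + T - ‖x‖)) (b2 := b 2 (x, R + T - ‖x‖))
      (z := z (x, R + T - ‖x‖)) hν)
    have h2 := mul_le_mul_of_nonneg_right hxb1 (bottom_flux_nonneg (a := a (x, ‖x‖))
      (b0 := b 0 (x, ‖x‖)) (b1 := b 1 (x, ‖x‖)) (b2 := b 2 (x, ‖x‖)) (z := z (x, ‖x‖))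
      (n0 := ‖x‖⁻¹ * x 0) (n1 := ‖x‖⁻¹ * x 1) (n2 := ‖x‖⁻¹ * x 2))
    have h3 := bottom_flux_eq (a := a (x, ‖x‖))
      (b0 := b 0 (x, ‖x‖)) (b1 := b 1 (x, ‖x‖)) (b2 := b 2 (x, ‖x‖)) (z := z (x, ‖x‖)) hν
    simp only [hf, hX, hEn]
    rw [h3] at h2
    linarith
  have hfin : exp (-l * T) * ∫ p in K, (z p ^ 2 + ∑ k, (b k p) ^ 2) ≤ ∫ p in K, f p := by
    rw [← integral_const_mul]
    refine setIntegral_mono_on (hfint (continuousOn_const.mul ((hz1.continuousOn.pow 2).add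
      (continuousOn_finsetSum _ fun k _ => (hbC k).continuousOn.pow 2)))) hwEint hKm
      fun p hp => ?_
    have hpT : p.2 ≤ T := by have := hp.2.2.2; have := hp.1; linarith
    have hww : exp (-l * T) ≤ w p := exp_le_exp.2 (by nlinarith)
    rw [Fin.sum_univ_three]
    refine mul_le_mul hww ?_ (by positivity) (exp_pos _).le
    simp only [hEn]
    nlinarith [sq_nonneg (a p)]
  have hexp : exp (l * T) * exp (-l * T) = 1 := by rw [← exp_add]; simp
  calc ∫ p in K, (z p ^ 2 + ∑ k, (b k p) ^ 2)
      = exp (l * T) * (exp (-l * T) * ∫ p in K, (z p ^ 2 + ∑ k, (b k p) ^ 2)) := by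
        rw [← mul_assoc, hexp, one_mul]
    _ ≤ _ := mul_le_mul_of_nonneg_left (by linarith) (exp_pos _).le

/-- The infinitesimal rotation `x ↦ xᵢ eⱼ - xⱼ eᵢ`. -/
def rotGen (i j : Fin 3) : E3 →L[ℝ] E3 :=
  (EuclideanSpace.proj i).smulRight (basis3 j) - (EuclideanSpace.proj j).smulRight (basis3 i)

lemma rotGen_apply (i j : Fin 3) (x : E3) :
    rotGen i j x = x i • basis3 j - x j • basis3 i := rfl

lemma ang_eq_fderiv (i j : Fin 3) (f : E3 → ℝ) (x : E3) :
    ang i j f x = fderiv ℝ f x (rotGen i j x) := by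
  rw [rotGen_apply, map_sub, map_smul, map_smul]
  rfl

lemma inner_rotGen_self (i j : Fin 3) (x : E3) : inner ℝ x (rotGen i j x) = 0 := by
  rw [rotGen_apply, inner_sub_right, inner_smul_right, inner_smul_right, inner_basis3, inner_basis3]
  ring

/-- Rotation by the angle `s` in the `(i,j)` coordinate plane. -/
def rot (i j : Fin 3) (s : ℝ) : E3 →L[ℝ] E3 :=
  ContinuousLinearMap.id ℝ E3 + sin s • rotGen i j +
    (1 - cos s) • (rotGen i j).comp (rotGen i j)

lemma rot_apply (i j : Fin 3) (s : ℝ) (x : E3) :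
    rot i j s x = x + sin s • rotGen i j x + (1 - cos s) • rotGen i j (rotGen i j x) := rfl

lemma rot_zero (i j : Fin 3) (x : E3) : rot i j 0 x = x := by simp [rot_apply]

lemma rotGen_rotGen_rotGen {i j : Fin 3} (hij : i ≠ j) (x : E3) :
    rotGen i j (rotGen i j (rotGen i j x)) = -rotGen i j x := by
  simp [rotGen_apply, basis3, hij, hij.symm]
  abel

lemma norm_rot {i j : Fin 3} (hij : i ≠ j) (s : ℝ) (x : E3) : ‖rot i j s x‖ = ‖x‖ := by
  have h := sin_sq_add_cos_sq s
  rw [← sq_eq_sq₀ (norm_nonneg _) (norm_nonneg _), EuclideanSpace.real_norm_sq_eq,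
    EuclideanSpace.real_norm_sq_eq]
  fin_cases i <;> fin_cases j <;> first
    | exact absurd rfl hij
    | (simp [rot_apply, rotGen_apply, basis3, Fin.sum_univ_three]
       first
        | linear_combination (x 0 ^ 2 + x 1 ^ 2) * h
        | linear_combination (x 0 ^ 2 + x 2 ^ 2) * h
        | linear_combination (x 1 ^ 2 + x 2 ^ 2) * h)

lemma hasDerivAt_rot {i j : Fin 3} (hij : i ≠ j) (s : ℝ) (x : E3) :
    HasDerivAt (fun s => rot i j s x) (rotGen i j (rot i j s x)) s := by
  have h := (((hasDerivAt_const s x).add ((hasDerivAt_sin s).smul_const (rotGen i j x))).add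
    (((hasDerivAt_const s (1 : ℝ)).sub (hasDerivAt_cos s)).smul_const
      (rotGen i j (rotGen i j x))))
  refine h.congr_deriv ?_
  rw [rot_apply, map_add, map_add, map_smul, map_smul, rotGen_rotGen_rotGen hij]
  module

lemma rot_basis3_left {i j : Fin 3} (hij : i ≠ j) (s : ℝ) :
    rot i j s (basis3 i) = cos s • basis3 i + sin s • basis3 j := by
  simp [rot_apply, rotGen_apply, basis3, hij, hij.symm]
  module

lemma rot_basis3_right {i j : Fin 3} (hij : i ≠ j) (s : ℝ) :
    rot i j s (basis3 j) = cos s • basis3 j - sin s • basis3 i := by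
  simp [rot_apply, rotGen_apply, basis3, hij, hij.symm]
  module

lemma rot_basis3_of_ne {i j k : Fin 3} (hi : k ≠ i) (hj : k ≠ j) (s : ℝ) :
    rot i j s (basis3 k) = basis3 k := by
  simp [rot_apply, rotGen_apply, basis3, hi.symm, hj.symm]

/-- A rotation as a linear isometric equivalence. -/
def rotIso {i j : Fin 3} (hij : i ≠ j) (s : ℝ) : E3 ≃ₗᵢ[ℝ] E3 :=
  LinearIsometry.toLinearIsometryEquiv ⟨(rot i j s).toLinearMap, norm_rot hij s⟩ rfl

lemma measurePreserving_rot {i j : Fin 3} (hij : i ≠ j) (s : ℝ) :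
    MeasurePreserving (rot i j s) volume volume :=
  (rotIso hij s).measurePreserving

lemma continuous_rot (i j : Fin 3) : Continuous fun p : E3 × ℝ => rot i j p.2 p.1 := by
  simp only [rot_apply]
  fun_prop

/-- The rotation acting on space-time, with time fixed. -/
def rotST (i j : Fin 3) (s : ℝ) : E3 × ℝ →L[ℝ] E3 × ℝ :=
  (rot i j s).prodMap (ContinuousLinearMap.id ℝ ℝ)

lemma rotST_apply (i j : Fin 3) (s : ℝ) (p : E3 × ℝ) :
    rotST i j s p = (rot i j s p.1, p.2) := rfl

lemma measurePreserving_rotST {i j : Fin 3} (hij : i ≠ j) (s : ℝ) :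
    MeasurePreserving (rotST i j s) volume volume :=
  (measurePreserving_rot hij s).prod (MeasurePreserving.id volume)

lemma continuous_rotST (i j : Fin 3) :
    Continuous fun p : (E3 × ℝ) × ℝ => rotST i j p.2 p.1 := by
  simp only [rotST_apply, rot_apply]
  fun_prop

lemma hasDerivAt_rotST {i j : Fin 3} (hij : i ≠ j) (s : ℝ) (p : E3 × ℝ) :
    HasDerivAt (fun s => rotST i j s p) (rotGen i j (rot i j s p.1), 0) s :=
  (hasDerivAt_rot hij s p.1).prodMk (hasDerivAt_const s p.2)

lemma rot_mem_Ann_iff {i j : Fin 3} (hij : i ≠ j) (s : ℝ) {R ρ : ℝ} {x : E3} :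
    rot i j s x ∈ Ann R ρ ↔ x ∈ Ann R ρ := by
  simp only [Ann, mem_ofPred_eq, norm_rot hij]

lemma rotST_mem_Kreg_iff {i j : Fin 3} (hij : i ≠ j) (s : ℝ) {R T ρ : ℝ} {p : E3 × ℝ} :
    rotST i j s p ∈ Kreg R T ρ ↔ p ∈ Kreg R T ρ := by
  simp only [Kreg, mem_ofPred_eq, rotST_apply, norm_rot hij]

lemma rotST_mem_cone_iff {i j : Fin 3} (hij : i ≠ j) (s : ℝ) {p : E3 × ℝ} :
    rotST i j s p ∈ cone ↔ p ∈ cone := by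
  simp only [cone, mem_ofPred_eq, rotST_apply, norm_rot hij]

lemma sq_difference_quotient_le {c c' g : ℝ → ℝ} {h : ℝ} (hh : 0 < h)
    (hc : ∀ s ∈ Icc 0 h, HasDerivAt c (c' s) s) (hc' : ContinuousOn c' (Icc 0 h))
    (hg : ContinuousOn g (Icc 0 h)) (hle : ∀ s ∈ Icc 0 h, c' s ^ 2 ≤ g s) :
    (h⁻¹ * (c h - c 0)) ^ 2 ≤ h⁻¹ * ∫ s in (0:ℝ)..h, g s := by
  rw [← uIcc_of_le hh.le] at hc hc' hg
  have hI := intervalIntegral.integral_eq_sub_of_hasDerivAt hc hc'.intervalIntegrable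
  set m := h⁻¹ * (c h - c 0) with hm
  have hmh : c h - c 0 = h * m := by rw [hm]; field_simp
  have h1 : ∫ s in (0:ℝ)..h, (2 * m * c' s - m ^ 2) ≤ ∫ s in (0:ℝ)..h, g s := by
    refine intervalIntegral.integral_mono_on hh.le
      ((continuousOn_const.mul hc').sub continuousOn_const).intervalIntegrable
      hg.intervalIntegrable fun s hs => ?_
    nlinarith [hle s hs, sq_nonneg (c' s - m)]
  have hc2 : IntervalIntegrable (fun s => 2 * m * c' s) volume 0 h :=
    (continuousOn_const.mul hc').intervalIntegrable
  rw [intervalIntegral.integral_sub hc2 intervalIntegrable_const,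
    intervalIntegral.integral_const_mul, hI, hmh] at h1
  simp only [intervalIntegral.integral_const, smul_eq_mul, sub_zero] at h1
  rw [inv_mul_eq_div, le_div_iff₀ hh]
  linarith

lemma setIntegral_comp_eq_of_invariant {α : Type*} [TopologicalSpace α]
    [SecondCountableTopology α] [MeasurableSpace α] [BorelSpace α] {μ : Measure α} {K : Set α}
    (hKm : MeasurableSet K) {φ : α → α} (hmp : MeasurePreserving φ μ μ)
    (hinv : ∀ x, φ x ∈ K ↔ x ∈ K) {ψ : α → ℝ} (hψ : ContinuousOn ψ K) :
    ∫ y in K, ψ (φ y) ∂μ = ∫ y in K, ψ y ∂μ := by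
  have h1 : MeasurePreserving φ (μ.restrict K) (μ.restrict K) := by
    have := hmp.restrict_preimage hKm
    rwa [show φ ⁻¹' K = K from Set.ext hinv] at this
  have h2 := integral_map (μ := μ.restrict K) h1.measurable.aemeasurable (f := ψ)
    (by rw [h1.map_eq]; exact hψ.aestronglyMeasurable hKm)
  rw [h1.map_eq] at h2
  exact h2.symm

lemma setIntegral_sq_le_of_orbit {α : Type*} [TopologicalSpace α] [SecondCountableTopology α]
    [MeasurableSpace α] [BorelSpace α] {μ : Measure α} [IsFiniteMeasureOnCompacts μ] [SFinite μ]
    {K : Set α} (hK : IsCompact K) (hKm : MeasurableSet K) {φ : ℝ → α → α}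
    (hφ : Continuous fun p : α × ℝ => φ p.2 p.1) (hmp : ∀ s, MeasurePreserving (φ s) μ μ)
    (hinv : ∀ s x, φ s x ∈ K ↔ x ∈ K) {ψ : α → ℝ} (hψ : ContinuousOn ψ K) {d : α → ℝ} {h : ℝ}
    (hh : 0 < h)
    (hd : ∀ᵐ y ∂μ.restrict K, d y ^ 2 ≤ h⁻¹ * ∫ s in (0:ℝ)..h, ψ (φ s y)) :
    ∫ y in K, d y ^ 2 ∂μ ≤ ∫ y in K, ψ y ∂μ := by
  have hF : Integrable (fun p : α × ℝ => ψ (φ p.2 p.1))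
      ((μ.restrict K).prod (volume.restrict (Ioc 0 h))) := by
    rw [Measure.prod_restrict]
    have hc : ContinuousOn (fun p : α × ℝ => ψ (φ p.2 p.1)) (K ×ˢ Icc 0 h) :=
      hψ.comp hφ.continuousOn fun p hp => (hinv _ _).2 hp.1
    exact (hc.integrableOn_of_subset_isCompact (hK.prod isCompact_Icc)
      (hKm.prod measurableSet_Icc) subset_rfl (hK.prod isCompact_Icc).measure_ne_top).mono_set
      (prod_mono subset_rfl Ioc_subset_Icc_self)
  have hswap := integral_integral_swap (f := fun y s => ψ (φ s y)) hF
  have hs : ∀ s, ∫ y in K, ψ (φ s y) ∂μ = ∫ y in K, ψ y ∂μ := fun s =>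
    setIntegral_comp_eq_of_invariant hKm (hmp s) (hinv s) hψ
  have hfint := hF.integral_prod_left
  calc ∫ y in K, d y ^ 2 ∂μ ≤ ∫ y in K, h⁻¹ * (∫ s in Ioc 0 h, ψ (φ s y)) ∂μ := by
        refine integral_mono_of_nonneg (Eventually.of_forall fun y => sq_nonneg _)
          (hfint.const_mul _) ?_
        filter_upwards [hd] with y hy
        rwa [intervalIntegral.integral_of_le hh.le] at hy
    _ = ∫ y in K, ψ y ∂μ := by
        rw [integral_const_mul, hswap]
        simp only [hs]
        simp [hh.le, hh.ne']

lemma sndFDeriv_comp_rotST {u : E3 × ℝ → ℝ} (hu : ContDiffOn ℝ 2 u cone) {i j : Fin 3}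
    (hij : i ≠ j) (s : ℝ) {p : E3 × ℝ} (hp : ‖p.1‖ < p.2) (v w : E3 × ℝ) :
    fderiv ℝ (fun r => fderiv ℝ (fun r => u (rotST i j s r)) r v) p w =
      fderiv ℝ (fun r => fderiv ℝ u r (rotST i j s v)) (rotST i j s p) (rotST i j s w) := by
  have hfint : ∀ r : E3 × ℝ, ‖r.1‖ < r.2 → ‖(rotST i j s r).1‖ < (rotST i j s r).2 := by
    intro r hr
    rwa [rotST_apply, norm_rot hij]
  have h1 : (fun r => fderiv ℝ (fun r => u (rotST i j s r)) r v) =ᶠ[𝓝 p]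
      fun r => fderiv ℝ u (rotST i j s r) (rotST i j s v) := by
    filter_upwards [eventually_interior_cone hp] with r hr
    have h2 := (hasFDerivAt_of_contDiffOn_cone (hu.of_le (by norm_num)) (hfint r hr)).comp r
      (rotST i j s).hasFDerivAt
    rw [HasFDerivAt.fderiv (f := fun r => u (rotST i j s r)) h2,
      (hasFDerivAt_of_contDiffOn_cone (hu.of_le (by norm_num)) (hfint r hr)).fderiv]
    rfl
  rw [h1.fderiv_eq]
  have hat : ContDiffAt ℝ 2 u (rotST i j s p) := hu.contDiffAt (cone_mem_nhds (hfint p hp))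
  have hd : DifferentiableAt ℝ (fderiv ℝ u) (rotST i j s p) :=
    (hat.fderiv_right (m := 1) (by norm_num)).differentiableAt one_ne_zero
  have hd' : DifferentiableAt ℝ (fun r => fderiv ℝ u r (rotST i j s v)) (rotST i j s p) :=
    hd.clm_apply (differentiableAt_const _)
  have h3 := hd'.hasFDerivAt.comp p (rotST i j s).hasFDerivAt
  rw [HasFDerivAt.fderiv (f := fun r => fderiv ℝ u (rotST i j s r) (rotST i j s v)) h3]
  rfl

lemma fderivWithin_fderivWithin_cone (z : E3 × ℝ → ℝ) {p : E3 × ℝ}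
    (hp : ‖p.1‖ < p.2) (v w : E3 × ℝ) :
    fderivWithin ℝ (fun r => fderivWithin ℝ z cone r v) cone p w =
      fderiv ℝ (fun r => fderiv ℝ z r v) p w := by
  have h2 : (fun r => fderivWithin ℝ z cone r v) =ᶠ[𝓝 p] fun r => fderiv ℝ z r v := by
    filter_upwards [eventually_interior_cone hp] with r hr
    rw [fderivWithin_of_mem_nhds (cone_mem_nhds hr)]
  rw [fderivWithin_of_mem_nhds (cone_mem_nhds hp), h2.fderiv_eq]

lemma differentiableAt_fderiv_apply {z : E3 × ℝ → ℝ} (hz : ContDiffOn ℝ 2 z cone) {p : E3 × ℝ}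
    (hp : ‖p.1‖ < p.2) : DifferentiableAt ℝ (fderiv ℝ z) p :=
  ((hz.contDiffAt (cone_mem_nhds hp)).fderiv_right (m := 1) (by norm_num)).differentiableAt
    one_ne_zero

lemma fderiv_fderiv_apply {z : E3 × ℝ → ℝ} (hz : ContDiffOn ℝ 2 z cone) {p : E3 × ℝ}
    (hp : ‖p.1‖ < p.2) (v w : E3 × ℝ) :
    fderiv ℝ (fun r => fderiv ℝ z r v) p w = fderiv ℝ (fderiv ℝ z) p w v := by
  have h1 : HasFDerivAt (fun r => fderiv ℝ z r v) ((fderiv ℝ (fderiv ℝ z) p).flip v) p :=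
    ((differentiableAt_fderiv_apply hz hp).hasFDerivAt.clm_apply
      (hasFDerivAt_const v p)).congr_fderiv (by ext <;> simp)
  rw [h1.fderiv]
  rfl

lemma sum_bilin_rot (B : E3 →L[ℝ] E3 →L[ℝ] ℝ) {i j : Fin 3} (hij : i ≠ j) (s : ℝ) :
    ∑ k, B (rot i j s (basis3 k)) (rot i j s (basis3 k)) = ∑ k, B (basis3 k) (basis3 k) := by
  have h := sin_sq_add_cos_sq s
  have hi := rot_basis3_left hij s
  have hj := rot_basis3_right hij s
  have hk := fun k hi hj => rot_basis3_of_ne (i := i) (j := j) (k := k) hi hj s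
  have e : B (rot i j s (basis3 i)) (rot i j s (basis3 i)) +
      B (rot i j s (basis3 j)) (rot i j s (basis3 j)) =
      B (basis3 i) (basis3 i) + B (basis3 j) (basis3 j) := by
    rw [hi, hj]
    simp only [map_add, map_sub, map_smul, add_apply, sub_apply, smul_apply,
      smul_eq_mul]
    linear_combination (B (basis3 i) (basis3 i) + B (basis3 j) (basis3 j)) * h
  rw [Fin.sum_univ_three, Fin.sum_univ_three]
  clear hi hj
  fin_cases i <;> fin_cases j <;> first
    | exact absurd rfl hij
    | (rw [hk 0 (by decide) (by decide)]
       simp only [Fin.reduceFinMk, Fin.mk_one] at e ⊢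
       linear_combination e)
    | (rw [hk 1 (by decide) (by decide)]
       simp only [Fin.reduceFinMk, Fin.zero_eta] at e ⊢
       linear_combination e)
    | (rw [hk 2 (by decide) (by decide)]
       simp only [Fin.zero_eta, Fin.mk_one] at e ⊢
       linear_combination e)

lemma wave_eq_sndFDeriv {z : E3 × ℝ → ℝ} (hz : ContDiffOn ℝ 2 z cone) {p : E3 × ℝ}
    (hp : ‖p.1‖ < p.2) : pdt (pdt z) p - lapX z p =
      fderiv ℝ (fderiv ℝ z) p (0, 1) (0, 1) -
        ∑ k, fderiv ℝ (fderiv ℝ z) p (basis3 k, 0) (basis3 k, 0) := by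
  rw [pdt_pdt_eq_fderivWithin hz hp, lapX_eq_fderivWithin hz hp]
  simp only [fderivWithin_fderivWithin_cone z hp, fderiv_fderiv_apply hz hp]

lemma contDiffOn_comp_rotST {u : E3 × ℝ → ℝ} {n : WithTop ℕ∞} (hu : ContDiffOn ℝ n u cone)
    {i j : Fin 3} (hij : i ≠ j) (s : ℝ) :
    ContDiffOn ℝ n (fun p => u (rotST i j s p)) cone :=
  hu.comp (rotST i j s).contDiff.contDiffOn fun _ hp => (rotST_mem_cone_iff hij s).2 hp

lemma wave_comp_rotST {u : E3 × ℝ → ℝ} (hu : ContDiffOn ℝ 2 u cone) {i j : Fin 3}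
    (hij : i ≠ j) (s : ℝ) {p : E3 × ℝ} (hp : ‖p.1‖ < p.2) :
    pdt (pdt fun r => u (rotST i j s r)) p - lapX (fun r => u (rotST i j s r)) p =
      pdt (pdt u) (rotST i j s p) - lapX u (rotST i j s p) := by
  have hp' : ‖(rotST i j s p).1‖ < (rotST i j s p).2 := by rwa [rotST_apply, norm_rot hij]
  have hu' := contDiffOn_comp_rotST hu hij s
  rw [wave_eq_sndFDeriv hu' hp, wave_eq_sndFDeriv hu hp']
  simp only [← fderiv_fderiv_apply hu' hp, sndFDeriv_comp_rotST hu hij s hp,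
    fderiv_fderiv_apply hu hp']
  have h1 : rotST i j s (0, 1) = (0, 1) := by simp [rotST_apply]
  rw [h1]
  congr 1
  exact sum_bilin_rot ((fderiv ℝ (fderiv ℝ u) (rotST i j s p)).bilinearComp
    (ContinuousLinearMap.inl ℝ E3 ℝ) (ContinuousLinearMap.inl ℝ E3 ℝ)) hij s

lemma wave_const_mul_sub {f g : E3 × ℝ → ℝ} (hf : ContDiffOn ℝ 2 f cone)
    (hg : ContDiffOn ℝ 2 g cone) (c : ℝ) {p : E3 × ℝ} (hp : ‖p.1‖ < p.2) :
    pdt (pdt fun r => c * (f r - g r)) p - lapX (fun r => c * (f r - g r)) p =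
      c * ((pdt (pdt f) p - lapX f p) - (pdt (pdt g) p - lapX g p)) := by
  have hz : ContDiffOn ℝ 2 (fun r => c * (f r - g r)) cone := contDiffOn_const.mul (hf.sub hg)
  have h1 : fderiv ℝ (fun r => c * (f r - g r)) =ᶠ[𝓝 p]
      fun r => c • (fderiv ℝ f r - fderiv ℝ g r) := by
    filter_upwards [eventually_interior_cone hp] with r hr
    have hfr := hasFDerivAt_of_contDiffOn_cone (hf.of_le (by norm_num)) hr
    have hgr := hasFDerivAt_of_contDiffOn_cone (hg.of_le (by norm_num)) hr
    rw [HasFDerivAt.fderiv (f := fun r => c * (f r - g r)) ((hfr.sub hgr).const_mul c),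
      hfr.fderiv, hgr.fderiv]
  have h2 := (((differentiableAt_fderiv_apply hf hp).hasFDerivAt.sub
    (differentiableAt_fderiv_apply hg hp).hasFDerivAt).const_smul c)
  rw [wave_eq_sndFDeriv hz hp, wave_eq_sndFDeriv hf hp, wave_eq_sndFDeriv hg hp, h1.fderiv_eq,
    HasFDerivAt.fderiv (f := fun r => c • (fderiv ℝ f r - fderiv ℝ g r)) h2]
  simp only [smul_apply, sub_apply, smul_eq_mul, Fin.sum_univ_three]
  ring

lemma fderiv_apply_eq_sum_pd (f : E3 → ℝ) (x v : E3) : fderiv ℝ f x v = ∑ k, v k * pd k f x := by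
  have hv : v = ∑ k, v k • basis3 k := by
    ext l
    simp [basis3, Fin.sum_univ_three]
    fin_cases l <;> simp
  conv_lhs => rw [hv]
  simp [pd]

lemma sq_fderiv_apply_le (f : E3 → ℝ) (x v : E3) :
    fderiv ℝ f x v ^ 2 ≤ ‖v‖ ^ 2 * gradsq f x := by
  rw [fderiv_apply_eq_sum_pd, EuclideanSpace.real_norm_sq_eq]
  exact Finset.sum_mul_sq_le_sq_mul_sq _ _ _

lemma gradsq_nonneg (f : E3 → ℝ) (x : E3) : 0 ≤ gradsq f x :=
  Finset.sum_nonneg fun _ _ => sq_nonneg _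

lemma norm_rotGen_le (i j : Fin 3) (x : E3) : ‖rotGen i j x‖ ≤ 2 * ‖x‖ := by
  rw [rotGen_apply]
  refine (norm_sub_le _ _).trans ?_
  rw [norm_smul, norm_smul, norm_basis3, norm_basis3]
  have := PiLp.norm_apply_le x i
  have := PiLp.norm_apply_le x j
  linarith

lemma sq_ang_le (i j : Fin 3) (f : E3 → ℝ) (x : E3) :
    ang i j f x ^ 2 ≤ 4 * ‖x‖ ^ 2 * gradsq f x := by
  rw [ang_eq_fderiv]
  refine (sq_fderiv_apply_le f x _).trans (mul_le_mul_of_nonneg_right ?_ (gradsq_nonneg f x))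
  nlinarith [norm_rotGen_le i j x, norm_nonneg (rotGen i j x), norm_nonneg x]

lemma pdr_eq_fderiv (f : E3 → ℝ) (x : E3) : pdr f x = ‖x‖⁻¹ * fderiv ℝ f x x := by
  rw [pdr, fderiv_apply_eq_sum_pd]

lemma sq_pdr_le (f : E3 → ℝ) {x : E3} (hx : x ≠ 0) : pdr f x ^ 2 ≤ gradsq f x := by
  rw [pdr_eq_fderiv, mul_pow]
  have h := sq_fderiv_apply_le f x x
  have hx' : 0 < ‖x‖ ^ 2 := by positivity
  rw [inv_pow, inv_mul_eq_div, div_le_iff₀ hx']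
  linarith

lemma hasDerivAt_comp_rot {f : E3 → ℝ} {i j : Fin 3} (hij : i ≠ j) {s : ℝ} {x : E3}
    (hf : DifferentiableAt ℝ f (rot i j s x)) :
    HasDerivAt (fun s => f (rot i j s x)) (ang i j f (rot i j s x)) s := by
  rw [ang_eq_fderiv]
  exact hf.hasFDerivAt.comp_hasDerivAt s (hasDerivAt_rot hij s x)

lemma hasFDerivAt_norm_mul {g : E3 → ℝ} {x : E3} (hx : x ≠ 0) (hg : DifferentiableAt ℝ g x) :
    HasFDerivAt (fun y => ‖y‖ * g y)
      (‖x‖ • fderiv ℝ g x + g x • ‖x‖⁻¹ • innerSL ℝ x) x :=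
  (hasFDerivAt_norm_E3 hx).mul hg.hasFDerivAt

lemma ang_norm_mul {g : E3 → ℝ} {x : E3} (hx : x ≠ 0) (hg : DifferentiableAt ℝ g x)
    (i j : Fin 3) : ang i j (fun y => ‖y‖ * g y) x = ‖x‖ * ang i j g x := by
  rw [ang_eq_fderiv, ang_eq_fderiv, (hasFDerivAt_norm_mul hx hg).fderiv]
  simp [inner_rotGen_self]

lemma fderiv_norm_mul_self {g : E3 → ℝ} {x : E3} (hx : x ≠ 0) (hg : DifferentiableAt ℝ g x) :
    ‖x‖⁻¹ * fderiv ℝ (fun y => ‖y‖ * g y) x x = g x + fderiv ℝ g x x := by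
  rw [(hasFDerivAt_norm_mul hx hg).fderiv]
  have hx' : ‖x‖ ≠ 0 := norm_ne_zero_iff.2 hx
  simp
  field_simp
  ring

lemma gradsq_le_gradsq_norm_mul {g : E3 → ℝ} {x : E3} (hx : x ≠ 0)
    (hg : DifferentiableAt ℝ g x) :
    ‖x‖ ^ 2 * gradsq g x ≤ 2 * (gradsq (fun y => ‖y‖ * g y) x + g x ^ 2) := by
  have h : ∀ k, pd k (fun y => ‖y‖ * g y) x = ‖x‖ * pd k g x + g x * (‖x‖⁻¹ * x k) := by
    intro k
    rw [pd, (hasFDerivAt_norm_mul hx hg).fderiv]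
    simp [inner_basis3, pd]
  have hν := sum_sq_normalized hx
  simp only [gradsq, Fin.sum_univ_three, h]
  have : g x ^ 2 = g x ^ 2 * ((‖x‖⁻¹ * x 0) ^ 2 + (‖x‖⁻¹ * x 1) ^ 2 + (‖x‖⁻¹ * x 2) ^ 2) := by
    rw [hν, mul_one]
  nlinarith [sq_nonneg (‖x‖ * pd 0 g x + 2 * (g x * (‖x‖⁻¹ * x 0))),
    sq_nonneg (‖x‖ * pd 1 g x + 2 * (g x * (‖x‖⁻¹ * x 1))),
    sq_nonneg (‖x‖ * pd 2 g x + 2 * (g x * (‖x‖⁻¹ * x 2)))]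

lemma pfun_eq_norm_mul (q : E3 → ℝ) (x : E3) :
    pfun q x = ‖x‖ * ∫ σ in (0:ℝ)..1, q (σ • x) := by
  rcases eq_or_ne x 0 with rfl | hx
  · simp [pfun]
  · have hx' : ‖x‖ ≠ 0 := norm_ne_zero_iff.2 hx
    rw [pfun, intervalIntegral.integral_comp_div (fun σ => q (σ • x)) hx', zero_div,
      div_self hx', smul_eq_mul]

lemma fderiv_pfun_self {q : E3 → ℝ} (hq : Continuous q) {x : E3} (hx : x ≠ 0)
    (hp : DifferentiableAt ℝ (pfun q) x) : fderiv ℝ (pfun q) x x = ‖x‖ * q x := by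
  have hx' : ‖x‖ ≠ 0 := norm_ne_zero_iff.2 hx
  have h1 : HasDerivAt (fun l : ℝ => l • x) x 1 := by
    simpa using (hasDerivAt_id (1 : ℝ)).smul_const x
  have h2 : HasDerivAt (fun l : ℝ => pfun q (l • x)) (fderiv ℝ (pfun q) x x) 1 := by
    have h3 : HasFDerivAt (pfun q) (fderiv ℝ (pfun q) x) ((1 : ℝ) • x) := by
      rw [one_smul]
      exact hp.hasFDerivAt
    exact h3.comp_hasDerivAt 1 h1
  have h4 : HasDerivAt (fun l : ℝ => ∫ σ in (0:ℝ)..(l * ‖x‖), q ((σ / ‖x‖) • x))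
      (q ((1 * ‖x‖ / ‖x‖) • x) * ‖x‖) 1 := by
    have hc : Continuous fun σ : ℝ => q ((σ / ‖x‖) • x) := by fun_prop
    have h5 := intervalIntegral.integral_hasDerivAt_right (hc.intervalIntegrable 0 (1 * ‖x‖))
      (hc.stronglyMeasurableAtFilter _ _) hc.continuousAt
    have h6 : HasDerivAt (fun l : ℝ => l * ‖x‖) ‖x‖ 1 := by
      simpa using (hasDerivAt_id (1 : ℝ)).mul_const ‖x‖
    exact h5.comp 1 h6
  have h7 : (fun l : ℝ => pfun q (l • x)) =ᶠ[𝓝 1]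
      fun l : ℝ => ∫ σ in (0:ℝ)..(l * ‖x‖), q ((σ / ‖x‖) • x) := by
    filter_upwards [lt_mem_nhds (show (0:ℝ) < 1 from one_pos)] with l hl
    rw [pfun, norm_smul, Real.norm_of_nonneg hl.le]
    refine intervalIntegral.integral_congr fun σ _ => ?_
    simp only [smul_smul]
    congr 2
    field_simp
  have h8 := (h4.congr_of_eventuallyEq h7).unique h2
  rw [← h8, one_mul, div_self hx', one_smul, mul_comm]

lemma pdr_ang_pfun {q : E3 → ℝ} (hq : ContDiff ℝ 1 q) {x : E3} (hx : x ≠ 0)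
    (hp : ContDiffOn ℝ 2 (pfun q) {0}ᶜ) (i j : Fin 3) :
    pdr (ang i j (pfun q)) x = ang i j q x := by
  have hx' : ‖x‖ ≠ 0 := norm_ne_zero_iff.2 hx
  have hnh : ∀ᶠ y in 𝓝 x, y ∈ ({0}ᶜ : Set E3) := isOpen_compl_singleton.mem_nhds hx
  have hat : ∀ y ∈ ({0}ᶜ : Set E3), ContDiffAt ℝ 2 (pfun q) y := fun y hy =>
    hp.contDiffAt (isOpen_compl_singleton.mem_nhds hy)
  have hd : HasFDerivAt (fderiv ℝ (pfun q)) (fderiv ℝ (fderiv ℝ (pfun q)) x) x :=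
    (((hat x hx).fderiv_right (m := 1) (by norm_num)).differentiableAt one_ne_zero).hasFDerivAt
  have hsym : IsSymmSndFDerivAt ℝ (pfun q) x := (hat x hx).isSymmSndFDerivAt (by simp)
  have h1 : HasFDerivAt (fun y => fderiv ℝ (pfun q) y y) _ x := hd.clm_apply (hasFDerivAt_id x)
  have h2 : (fun y => fderiv ℝ (pfun q) y y) =ᶠ[𝓝 x] fun y => ‖y‖ * q y := by
    filter_upwards [hnh] with y hy
    exact fderiv_pfun_self hq.continuous hy ((hat y hy).differentiableAt two_ne_zero)
  have h3 := ang_norm_mul hx (hq.differentiable one_ne_zero x) i j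
  rw [ang_eq_fderiv, ← h2.fderiv_eq, h1.fderiv] at h3
  have h4 : HasFDerivAt (fun y => fderiv ℝ (pfun q) y (rotGen i j y)) _ x :=
    hd.clm_apply (rotGen i j).hasFDerivAt
  have h5 : ang i j (pfun q) = fun y => fderiv ℝ (pfun q) y (rotGen i j y) :=
    funext fun y => ang_eq_fderiv i j _ y
  rw [pdr_eq_fderiv, h5, h4.fderiv]
  simp at h3 ⊢
  rw [hsym x (rotGen i j x), inv_mul_eq_div, div_eq_iff hx', mul_comm _ ‖x‖]
  linarith

lemma contDiffOn_pd {f : E3 → ℝ} (hf : ContDiffOn ℝ 2 f {0}ᶜ) (k : Fin 3) :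
    ContDiffOn ℝ 1 (pd k f) {0}ᶜ :=
  (hf.fderiv_of_isOpen isOpen_compl_singleton (by norm_num)).clm_apply contDiffOn_const

lemma contDiffOn_ang {f : E3 → ℝ} (hf : ContDiffOn ℝ 2 f {0}ᶜ) (i j : Fin 3) :
    ContDiffOn ℝ 1 (ang i j f) {0}ᶜ := by
  have hc : ∀ k : Fin 3, ContDiffOn ℝ 1 (fun x : E3 => x k) {0}ᶜ := fun k =>
    (EuclideanSpace.proj (𝕜 := ℝ) k).contDiff.contDiffOn
  exact ((hc i).mul (contDiffOn_pd hf j)).sub ((hc j).mul (contDiffOn_pd hf i))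

lemma continuousOn_gradsq {f : E3 → ℝ} (hf : ContDiffOn ℝ 1 f {0}ᶜ) :
    ContinuousOn (gradsq f) {0}ᶜ := by
  refine continuousOn_finsetSum _ fun k _ => ContinuousOn.pow ?_ 2
  exact (hf.continuousOn_fderiv_of_isOpen isOpen_compl_singleton le_rfl).clm_apply
    continuousOn_const

lemma contDiffOn_bottom {u : E3 × ℝ → ℝ} (hu : ContDiffOn ℝ 2 u cone) :
    ContDiffOn ℝ 2 (fun x : E3 => u (x, ‖x‖)) {0}ᶜ :=
  hu.comp (contDiffOn_id.prodMk (contDiffOn_id.norm ℝ fun _ hx => hx)) fun x _ => le_refl ‖x‖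

lemma rot_ne_zero {i j : Fin 3} (hij : i ≠ j) (s : ℝ) {x : E3} (hx : x ≠ 0) :
    rot i j s x ≠ 0 := by
  rwa [← norm_pos_iff, norm_rot hij, norm_pos_iff]

lemma continuous_rot_param (i j : Fin 3) (x : E3) : Continuous fun s => rot i j s x := by
  simp only [rot_apply]
  fun_prop

lemma Ann_subset_compl_zero {R ρ : ℝ} (hR : 0 < R) : Ann R ρ ⊆ {0}ᶜ := fun _ hx =>
  ne_zero_of_mem_Ann hR hx

lemma setIntegral_Ann_rot_quotient_le {R ρ : ℝ} (hR : 0 < R) {i j : Fin 3} (hij : i ≠ j)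
    {f g : E3 → ℝ} {c c' : E3 → ℝ → ℝ} (hg : ContinuousOn g {0}ᶜ) {h : ℝ} (hh : 0 < h)
    (hf : ∀ x, x ≠ 0 → f x = h⁻¹ * (c x h - c x 0))
    (hc : ∀ x, x ≠ 0 → ∀ s, HasDerivAt (c x) (c' x s) s)
    (hc' : ∀ x, x ≠ 0 → Continuous (c' x))
    (hle : ∀ x, x ≠ 0 → ∀ s, c' x s ^ 2 ≤ g (rot i j s x)) :
    ∫ x in Ann R ρ, f x ^ 2 ≤ ∫ x in Ann R ρ, g x := by
  refine setIntegral_sq_le_of_orbit (isCompact_Ann R ρ) (measurableSet_Ann R ρ)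
    (φ := fun s x => rot i j s x) (continuous_rot i j) (measurePreserving_rot hij)
    (fun s x => rot_mem_Ann_iff hij s) (hg.mono (Ann_subset_compl_zero hR)) hh ?_
  filter_upwards [ae_restrict_mem (measurableSet_Ann R ρ)] with x hxA
  have hx := ne_zero_of_mem_Ann hR hxA
  rw [hf x hx]
  exact sq_difference_quotient_le hh (fun s _ => hc x hx s) (hc' x hx).continuousOn
    (hg.comp (continuous_rot_param i j x).continuousOn fun s _ => rot_ne_zero hij s hx)
    fun s _ => hle x hx s

lemma differentiableAt_of_ne_zero {f : E3 → ℝ} (hf : ContDiffOn ℝ 1 f {0}ᶜ) {x : E3}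
    (hx : x ≠ 0) : DifferentiableAt ℝ f x :=
  (hf.contDiffAt (isOpen_compl_singleton.mem_nhds hx)).differentiableAt one_ne_zero

lemma setIntegral_Ann_sq_rot_quotient_le {R ρ : ℝ} (hR : 0 < R) {i j : Fin 3} (hij : i ≠ j)
    {f : E3 → ℝ} (hf : ContDiffOn ℝ 2 f {0}ᶜ) {h : ℝ} (hh : 0 < h) :
    ∫ x in Ann R ρ, (h⁻¹ * (f (rot i j h x) - f x)) ^ 2 ≤ ∫ x in Ann R ρ, ang i j f x ^ 2 := by
  have hac := (contDiffOn_ang hf i j).continuousOn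
  refine setIntegral_Ann_rot_quotient_le hR hij (c := fun x s => f (rot i j s x))
    (c' := fun x s => ang i j f (rot i j s x)) (hac.pow 2) hh ?_ ?_ ?_ ?_
  · intro x _
    rw [rot_zero]
  · intro x hx s
    exact hasDerivAt_comp_rot hij
      (differentiableAt_of_ne_zero (hf.of_le (by norm_num)) (rot_ne_zero hij s hx))
  · intro x hx
    exact hac.comp_continuous (continuous_rot_param i j x) fun s => rot_ne_zero hij s hx
  · intro x _ s
    exact le_rfl

lemma setIntegral_Ann_gradsq_rot_quotient_le {R ρ : ℝ} (hR : 0 < R) {i j : Fin 3}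
    (hij : i ≠ j) {f : E3 → ℝ} (hf : ContDiffOn ℝ 2 f {0}ᶜ) {h : ℝ} (hh : 0 < h) :
    ∫ x in Ann R ρ, gradsq (fun y => h⁻¹ * (f (rot i j h y) - f y)) x ≤
      3 * ∫ x in Ann R ρ, gradsq (ang i j f) x := by
  have hf1 : ContDiffOn ℝ 1 f {0}ᶜ := hf.of_le (by norm_num)
  have haC := contDiffOn_ang hf i j
  have hQ : ContDiffOn ℝ 2 (fun y => h⁻¹ * (f (rot i j h y) - f y)) {0}ᶜ :=
    contDiffOn_const.mul ((hf.comp (rot i j h).contDiff.contDiffOn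
      fun x hx => rot_ne_zero hij h hx).sub hf)
  have hpd : ∀ k x, x ≠ 0 → pd k (fun y => h⁻¹ * (f (rot i j h y) - f y)) x =
      h⁻¹ * (fderiv ℝ f (rot i j h x) (rot i j h (basis3 k)) - fderiv ℝ f x (basis3 k)) := by
    intro k x hx
    have h1 := (differentiableAt_of_ne_zero hf1 (rot_ne_zero hij h hx)).hasFDerivAt.comp x
      (rot i j h).hasFDerivAt
    have h2 := (h1.sub (differentiableAt_of_ne_zero hf1 hx).hasFDerivAt).const_mul h⁻¹
    rw [pd, HasFDerivAt.fderiv (f := fun y => h⁻¹ * (f (rot i j h y) - f y)) h2]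
    rfl
  have hk : ∀ k, ∫ x in Ann R ρ, (pd k (fun y => h⁻¹ * (f (rot i j h y) - f y)) x) ^ 2 ≤
      ∫ x in Ann R ρ, gradsq (ang i j f) x := by
    intro k
    refine setIntegral_Ann_rot_quotient_le hR hij
      (c := fun x s => fderiv ℝ f (rot i j s x) (rot i j s (basis3 k)))
      (c' := fun x s => fderiv ℝ (ang i j f) (rot i j s x) (rot i j s (basis3 k)))
      (continuousOn_gradsq haC) hh ?_ ?_ ?_ ?_
    · intro x hx
      rw [hpd k x hx, rot_zero, rot_zero]
    · intro x hx s
      have hy := rot_ne_zero hij s hx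
      have hat : ContDiffAt ℝ 2 f (rot i j s x) :=
        hf.contDiffAt (isOpen_compl_singleton.mem_nhds hy)
      have hd : HasFDerivAt (fderiv ℝ f) (fderiv ℝ (fderiv ℝ f) (rot i j s x)) (rot i j s x) :=
        ((hat.fderiv_right (m := 1) (by norm_num)).differentiableAt one_ne_zero).hasFDerivAt
      have hsym : IsSymmSndFDerivAt ℝ f (rot i j s x) := hat.isSymmSndFDerivAt (by simp)
      have h1 : HasDerivAt (fun s => fderiv ℝ f (rot i j s x)) _ s :=
        hd.comp_hasDerivAt s (hasDerivAt_rot hij s x)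
      refine (h1.clm_apply (hasDerivAt_rot hij s (basis3 k))).congr_deriv ?_
      have h5 : ang i j f = fun y => fderiv ℝ f y (rotGen i j y) :=
        funext fun y => ang_eq_fderiv i j _ y
      have h4 : HasFDerivAt (fun y => fderiv ℝ f y (rotGen i j y)) _ (rot i j s x) :=
        hd.clm_apply (rotGen i j).hasFDerivAt
      rw [h5, h4.fderiv, hsym]
      simp [add_comm]
    · intro x hx
      have h1 := (haC.continuousOn_fderiv_of_isOpen isOpen_compl_singleton le_rfl).comp_continuous
        (continuous_rot_param i j x) fun s => rot_ne_zero hij s hx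
      exact h1.clm_apply (continuous_rot_param i j (basis3 k))
    · intro x _ s
      have := sq_fderiv_apply_le (ang i j f) (rot i j s x) (rot i j s (basis3 k))
      rwa [norm_rot hij, norm_basis3, one_pow, one_mul] at this
  have hfint : ∀ k, IntegrableOn
      (fun x => (pd k (fun y => h⁻¹ * (f (rot i j h y) - f y)) x) ^ 2) (Ann R ρ) := fun k =>
    (((contDiffOn_pd hQ k).continuousOn.pow 2).mono
      (Ann_subset_compl_zero hR)).integrableOn_compact (isCompact_Ann R ρ)
  simp only [gradsq]
  rw [integral_finsetSum _ fun k _ => hfint k, Fin.sum_univ_three]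
  have := hk 0
  have := hk 1
  have := hk 2
  simp only [gradsq] at *
  linarith

lemma norm_rotST_fst_lt {i j : Fin 3} (hij : i ≠ j) (s : ℝ) {p : E3 × ℝ} (hp : ‖p.1‖ < p.2) :
    ‖(rotST i j s p).1‖ < (rotST i j s p).2 := by
  rw [rotST_apply]
  change ‖rot i j s p.1‖ < p.2
  rwa [norm_rot hij]

lemma hasDerivAt_comp_rotST {i j : Fin 3} (hij : i ≠ j) {F : E3 × ℝ → ℝ}
    (hF : ContDiffOn ℝ 1 F cone) {p : E3 × ℝ} (hp : ‖p.1‖ < p.2) (s : ℝ) :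
    HasDerivAt (fun s => F (rotST i j s p)) (fderivWithin ℝ F cone (rotST i j s p)
      (rotGen i j (rotST i j s p).1, 0)) s :=
  HasFDerivAt.comp_hasDerivAt (f := fun s => rotST i j s p) (l := F) s
    (hasFDerivAt_of_contDiffOn_cone hF (norm_rotST_fst_lt hij s hp)) (hasDerivAt_rotST hij s p)

lemma sq_rotST_difference_quotient_le {i j : Fin 3} (hij : i ≠ j)
    {F : E3 × ℝ → ℝ} (hF : ContDiffOn ℝ 1 F cone) {h : ℝ} (hh : 0 < h) {p : E3 × ℝ}
    (hp : ‖p.1‖ < p.2) :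
    (h⁻¹ * (F (rotST i j h p) - F p)) ^ 2 ≤ h⁻¹ * ∫ s in (0:ℝ)..h,
      (fderivWithin ℝ F cone (rotST i j s p) (rotGen i j (rotST i j s p).1, 0)) ^ 2 := by
  have hcc : ContinuousOn (fun p => fderivWithin ℝ F cone p (rotGen i j p.1, 0)) cone :=
    (continuousOn_fderivWithin_cone hF).clm_apply (by fun_prop)
  have hp0 : rotST i j 0 p = p := by simp [rotST_apply, rot_zero]
  have hcont : Continuous fun s => rotST i j s p :=
    continuous_iff_continuousAt.2 fun s => (hasDerivAt_rotST hij s p).continuousAt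
  have hc' : Continuous fun s => fderivWithin ℝ F cone (rotST i j s p)
      (rotGen i j (rotST i j s p).1, 0) :=
    hcc.comp_continuous hcont fun s => (norm_rotST_fst_lt hij s hp).le
  have := sq_difference_quotient_le (c := fun s => F (rotST i j s p))
    (c' := fun s => fderivWithin ℝ F cone (rotST i j s p) (rotGen i j (rotST i j s p).1, 0))
    (g := fun s => (fderivWithin ℝ F cone (rotST i j s p)
      (rotGen i j (rotST i j s p).1, 0)) ^ 2) hh
    (fun s _ => hasDerivAt_comp_rotST hij hF hp s) hc'.continuousOn (hc'.pow 2).continuousOn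
    fun s _ => le_rfl
  simp only [hp0] at this
  exact this

lemma setIntegral_Kreg_sq_rot_quotient_le {R T ρ : ℝ} {i j : Fin 3} (hij : i ≠ j)
    {F : E3 × ℝ → ℝ} (hF : ContDiffOn ℝ 1 F cone) {h : ℝ} (hh : 0 < h) :
    ∫ p in Kreg R T ρ, (h⁻¹ * (F (rotST i j h p) - F p)) ^ 2 ≤
      ∫ p in Kreg R T ρ, (fderivWithin ℝ F cone p (rotGen i j p.1, 0)) ^ 2 := by
  have hcc : ContinuousOn (fun p => fderivWithin ℝ F cone p (rotGen i j p.1, 0)) cone :=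
    (continuousOn_fderivWithin_cone hF).clm_apply (by fun_prop)
  refine setIntegral_sq_le_of_orbit (isCompact_Kreg R T ρ) (isCompact_Kreg R T ρ).measurableSet
    (φ := fun s x => rotST i j s x) (continuous_rotST i j) (measurePreserving_rotST hij)
    (fun s x => rotST_mem_Kreg_iff hij s) ((hcc.pow 2).mono (Kreg_subset_cone R T ρ)) hh ?_
  filter_upwards [ae_Kreg_interior R T ρ] with p hp
  exact sq_rotST_difference_quotient_le hij hF hh hp.2

lemma setIntegral_Kreg_comp_fst_le {R T : ℝ} {g : E3 → ℝ}
    (hg : ContinuousOn g (Ann R ((R + T) / 2))) (hg0 : ∀ x, 0 ≤ g x) :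
    ∫ p in Kreg R T ((R + T) / 2), g p.1 ≤ (T - R) * ∫ x in Ann R ((R + T) / 2), g x := by
  have hc : ContinuousOn (fun p : E3 × ℝ => g p.1) (Kreg R T ((R + T) / 2)) :=
    hg.comp continuousOn_fst fun p hp => ⟨hp.1, hp.2.1⟩
  rw [setIntegral_Kreg (hc.integrableOn_compact (isCompact_Kreg R T _)), ← integral_const_mul]
  simp only [intervalIntegral.integral_const, smul_eq_mul]
  refine setIntegral_mono_on ?_ ?_ (measurableSet_Ann R _) fun x hx => ?_
  · exact (ContinuousOn.mul (by fun_prop) hg).integrableOn_compact (isCompact_Ann R _)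
  · exact (continuousOn_const.mul hg).integrableOn_compact (isCompact_Ann R _)
  · have := hx.1
    exact mul_le_mul_of_nonneg_right (by linarith) (hg0 x)

lemma continuousOn_ang {f : E3 → ℝ} (hf : ContDiffOn ℝ 1 f {0}ᶜ) (i j : Fin 3) :
    ContinuousOn (ang i j f) {0}ᶜ := by
  have h : ContinuousOn (fun x => fderiv ℝ f x (rotGen i j x)) {0}ᶜ :=
    (hf.continuousOn_fderiv_of_isOpen isOpen_compl_singleton le_rfl).clm_apply (by fun_prop)
  exact h.congr fun x _ => ang_eq_fderiv i j f x

lemma sq_ang_le_gradsq_norm_mul {Q : E3 → ℝ} {x : E3} (hx : x ≠ 0)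
    (hQ : DifferentiableAt ℝ Q x) (i j : Fin 3) :
    ang i j Q x ^ 2 ≤ 4 * gradsq (fun y => ‖y‖ * Q y) x := by
  have h1 := sq_ang_le i j (fun y => ‖y‖ * Q y) x
  rw [ang_norm_mul hx hQ, mul_pow] at h1
  have h2 : 0 < ‖x‖ ^ 2 := by positivity
  refine le_of_mul_le_mul_left ?_ h2
  linarith

lemma gradsq_ang_le {R : ℝ} (hR : 0 < R) {Q : E3 → ℝ} (hQ : ContDiffOn ℝ 2 Q {0}ᶜ) {x : E3}
    (hx : R ≤ ‖x‖) (i j : Fin 3) :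
    gradsq (ang i j Q) x ≤ 2 * (R ^ 2)⁻¹ *
      (gradsq (ang i j (fun y => ‖y‖ * Q y)) x + 4 * gradsq (fun y => ‖y‖ * Q y) x) := by
  have hx0 : x ≠ 0 := norm_pos_iff.1 (hR.trans_le hx)
  have hQ1 : ContDiffOn ℝ 1 Q {0}ᶜ := hQ.of_le (by norm_num)
  have h1 := gradsq_le_gradsq_norm_mul hx0
    (differentiableAt_of_ne_zero (contDiffOn_ang hQ i j) hx0)
  have h2 : (fun y => ‖y‖ * ang i j Q y) =ᶠ[𝓝 x] ang i j (fun y => ‖y‖ * Q y) := by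
    filter_upwards [isOpen_compl_singleton.mem_nhds hx0] with y hy
    exact (ang_norm_mul hy (differentiableAt_of_ne_zero hQ1 hy) i j).symm
  have h3 : gradsq (fun y => ‖y‖ * ang i j Q y) x =
      gradsq (ang i j (fun y => ‖y‖ * Q y)) x := by
    simp only [gradsq, pd, h2.fderiv_eq]
  rw [h3] at h1
  have h4 := sq_ang_le_gradsq_norm_mul hx0 (differentiableAt_of_ne_zero hQ1 hx0) i j
  have h5 : R ^ 2 * gradsq (ang i j Q) x ≤ ‖x‖ ^ 2 * gradsq (ang i j Q) x :=
    mul_le_mul_of_nonneg_right (by gcongr) (gradsq_nonneg _ _)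
  rw [mul_comm 2, mul_assoc, le_inv_mul_iff₀ (by positivity)]
  linarith

lemma integrableOn_gradsq_add_gradsq_ang {R ρ : ℝ} (hR : 0 < R) {f : E3 → ℝ}
    (hf : ContDiffOn ℝ 2 f {0}ᶜ) (i j : Fin 3) :
    IntegrableOn (fun x => gradsq f x + gradsq (ang i j f) x) (Ann R ρ) :=
  (((continuousOn_gradsq (hf.of_le (by norm_num))).add
    (continuousOn_gradsq (contDiffOn_ang hf i j))).mono
      (Ann_subset_compl_zero hR)).integrableOn_compact (isCompact_Ann R ρ)

lemma contDiffOn_norm_mul {n : WithTop ℕ∞} {Q : E3 → ℝ} (hQ : ContDiffOn ℝ n Q {0}ᶜ) :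
    ContDiffOn ℝ n (fun y => ‖y‖ * Q y) {0}ᶜ :=
  (contDiffOn_id.norm ℝ fun _ hx => hx).mul hQ

lemma setIntegral_Ann_initial_energy_le {R ρ : ℝ} (hR : 0 < R) {i j : Fin 3} (hij : i ≠ j)
    {Q : E3 → ℝ} (hQ : ContDiffOn ℝ 2 Q {0}ᶜ) {h : ℝ} (hh : 0 < h) :
    ∫ x in Ann R ρ, ((h⁻¹ * (Q (rot i j h x) - Q x)) ^ 2 +
        gradsq (fun y => h⁻¹ * (Q (rot i j h y) - Q y)) x) ≤
      (4 + 24 * (R ^ 2)⁻¹) * ∫ x in Ann R ρ, (gradsq (fun y => ‖y‖ * Q y) x +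
        gradsq (ang i j (fun y => ‖y‖ * Q y)) x) := by
  have hQ1 : ContDiffOn ℝ 1 Q {0}ᶜ := hQ.of_le (by norm_num)
  have hP : ContDiffOn ℝ 1 (fun y => h⁻¹ * (Q (rot i j h y) - Q y)) {0}ᶜ :=
    contDiffOn_const.mul ((hQ1.comp (rot i j h).contDiff.contDiffOn
      fun x hx => rot_ne_zero hij h hx).sub hQ1)
  have hi : ∀ {g : E3 → ℝ}, ContinuousOn g {0}ᶜ → IntegrableOn g (Ann R ρ) := fun hg =>
    (hg.mono (Ann_subset_compl_zero hR)).integrableOn_compact (isCompact_Ann R ρ)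
  have h1 : IntegrableOn (fun x => (h⁻¹ * (Q (rot i j h x) - Q x)) ^ 2) (Ann R ρ) :=
    hi (hP.continuousOn.pow 2)
  rw [integral_add h1 (hi (continuousOn_gradsq hP)), ← integral_const_mul]
  have h2 : IntegrableOn (fun x => ang i j Q x ^ 2) (Ann R ρ) :=
    hi ((continuousOn_ang hQ1 i j).pow 2)
  have h3 : IntegrableOn (fun x => 3 * gradsq (ang i j Q) x) (Ann R ρ) :=
    hi (continuousOn_const.mul (continuousOn_gradsq (contDiffOn_ang hQ i j)))
  have h4 := setIntegral_Ann_sq_rot_quotient_le (ρ := ρ) hR hij hQ hh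
  have h5 := setIntegral_Ann_gradsq_rot_quotient_le (ρ := ρ) hR hij hQ hh
  rw [← integral_const_mul] at h5
  refine (add_le_add h4 h5).trans ?_
  rw [← integral_add h2 h3]
  refine setIntegral_mono_on (h2.add h3) ((integrableOn_gradsq_add_gradsq_ang hR
    (contDiffOn_norm_mul hQ) i j).const_mul _) (measurableSet_Ann R ρ) fun x hx => ?_
  have hx0 : x ≠ 0 := Ann_subset_compl_zero hR hx
  have h6 := sq_ang_le_gradsq_norm_mul hx0 (differentiableAt_of_ne_zero hQ1 hx0) i j
  have h7 := gradsq_ang_le hR hQ hx.1 i j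
  have h8 := gradsq_nonneg (ang i j (fun y => ‖y‖ * Q y)) x
  have h9 := mul_nonneg (inv_nonneg.2 (sq_nonneg R)) h8
  linarith

lemma sq_le_gradsq_pfun {q : E3 → ℝ} (hq : ContDiff ℝ 1 q) {x : E3} (hx : x ≠ 0)
    (hp : ContDiffOn ℝ 2 (pfun q) {0}ᶜ) (i j : Fin 3) :
    q x ^ 2 + ang i j q x ^ 2 ≤ gradsq (pfun q) x + gradsq (ang i j (pfun q)) x := by
  have h1 := sq_pdr_le (pfun q) hx
  have h2 := sq_pdr_le (ang i j (pfun q)) hx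
  rw [pdr_ang_pfun hq hx hp] at h2
  rw [pdr_eq_fderiv, fderiv_pfun_self hq.continuous hx
    (differentiableAt_of_ne_zero (hp.of_le (by norm_num)) hx),
    inv_mul_cancel_left₀ (norm_ne_zero_iff.2 hx)] at h1
  exact add_le_add h1 h2

lemma abs_ang_le {f : E3 → ℝ} {x : E3} {M B : ℝ} (hx : ‖x‖ ≤ B) (hf : ∀ k, |pd k f x| ≤ M)
    (i j : Fin 3) : |ang i j f x| ≤ 2 * B * M := by
  have hi : ∀ k, |x k| ≤ B := fun k => (PiLp.norm_apply_le x k).trans hx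
  have hM : ∀ k l, |x k * pd l f x| ≤ B * M := fun k l => by
    rw [abs_mul]
    exact mul_le_mul (hi k) (hf l) (abs_nonneg _) ((abs_nonneg _).trans (hi k))
  refine (abs_sub _ _).trans ?_
  linarith [hM i j, hM j i]

lemma sq_rot_quotient_le {f : E3 → ℝ} (hf : ContDiff ℝ 1 f) {i j : Fin 3} (hij : i ≠ j)
    {R ρ N : ℝ} (hN : ∀ x ∈ Ann R ρ, |ang i j f x| ≤ N) {h : ℝ} (hh : 0 < h) {x : E3}
    (hx : x ∈ Ann R ρ) : (h⁻¹ * (f (rot i j h x) - f x)) ^ 2 ≤ N ^ 2 := by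
  have hc : Continuous fun s => ang i j f (rot i j s x) := by
    simp only [ang_eq_fderiv]
    exact ((hf.continuous_fderiv one_ne_zero).comp (continuous_rot_param i j x)).clm_apply
      ((rotGen i j).continuous.comp (continuous_rot_param i j x))
  have h1 := sq_difference_quotient_le (c := fun s => f (rot i j s x))
    (c' := fun s => ang i j f (rot i j s x)) (g := fun _ => N ^ 2) hh
    (fun s _ => hasDerivAt_comp_rot hij (hf.differentiable one_ne_zero _))
    hc.continuousOn continuousOn_const
    fun s _ => sq_le_sq' (abs_le.1 (hN _ ((rot_mem_Ann_iff hij s).2 hx))).1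
      (abs_le.1 (hN _ ((rot_mem_Ann_iff hij s).2 hx))).2
  simpa [rot_zero, hh.ne'] using h1

lemma rot_quotient_energy_le {R T M : ℝ} (hR : 0 < R) (hRT : R < T) {i j : Fin 3} (hij : i ≠ j)
    {q : E3 → ℝ} (hq : ContDiff ℝ 1 q)
    (hqM : ∀ x ∈ Ann R ((R + T) / 2), |q x| ≤ M ∧ ∀ k : Fin 3, |pd k q x| ≤ M)
    {u F : E3 × ℝ → ℝ} (hu : ContDiffOn ℝ 2 u cone) (hF : ContDiffOn ℝ 1 F cone)
    (heq : ∀ p : E3 × ℝ, ‖p.1‖ < p.2 → pdt (pdt u) p - lapX u p = q p.1 * u p + F p)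
    (hside : ∀ x, ‖x‖ = R → ∀ t, R < t → t < T → u (x, t) = 0) {h : ℝ} (hh : 0 < h) :
    ∫ p in Kreg R T ((R + T) / 2), ((h⁻¹ * (u (rotST i j h p) - u p)) ^ 2 +
        ∑ k, (fderivWithin ℝ (fun p => h⁻¹ * (u (rotST i j h p) - u p)) cone p
          (basis3 k, 0)) ^ 2) ≤
      exp ((3 + 2 * M ^ 2) * T) * ((4 + 24 * (R ^ 2)⁻¹) *
        (∫ x in Ann R ((R + T) / 2), (gradsq (fun y => ‖y‖ * u (y, ‖y‖)) x +
          gradsq (ang i j (fun y => ‖y‖ * u (y, ‖y‖))) x)) +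
        16 * T ^ 2 * M ^ 2 * (∫ p in Kreg R T ((R + T) / 2), u p ^ 2) +
        4 * ∫ p in Kreg R T ((R + T) / 2),
          (fderivWithin ℝ F cone p (rotGen i j p.1, 0)) ^ 2) := by
  set K := Kreg R T ((R + T) / 2) with hKdef
  have hK : IsCompact K := isCompact_Kreg R T _
  have hKc : K ⊆ cone := Kreg_subset_cone R T _
  have huh := contDiffOn_comp_rotST hu hij h
  have hFh := contDiffOn_comp_rotST hF hij h
  have hz : ContDiffOn ℝ 2 (fun p => h⁻¹ * (u (rotST i j h p) - u p)) cone :=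
    contDiffOn_const.mul (huh.sub hu)
  have hDF : ContDiffOn ℝ 1 (fun p => h⁻¹ * (F (rotST i j h p) - F p)) cone :=
    contDiffOn_const.mul (hFh.sub hF)
  have hDq : Continuous fun p : E3 × ℝ => h⁻¹ * (q (rot i j h p.1) - q p.1) :=
    continuous_const.mul ((hq.continuous.comp ((rot i j h).continuous.comp continuous_fst)).sub
      (hq.continuous.comp continuous_fst))
  set G : E3 × ℝ → ℝ := fun p => h⁻¹ * (q (rot i j h p.1) - q p.1) * u (rotST i j h p) +
    h⁻¹ * (F (rotST i j h p) - F p) with hG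
  have hGc : ContinuousOn G K :=
    ((hDq.continuousOn.mul huh.continuousOn).add hDF.continuousOn).mono hKc
  have hen := energy_Kreg (M := M) (G := G) (q := q) hR hRT hz ?_ (fun x hx => (hqM x hx).1)
    hGc ?_
  rotate_left
  · intro x hx t ht1 ht2
    have h1 : u (rotST i j h (x, t)) = 0 := by
      rw [rotST_apply]
      exact hside _ (by rw [norm_rot hij, hx]) t ht1 ht2
    rw [h1, hside x hx t ht1 ht2, sub_zero, mul_zero]
  · intro p _ hp
    rw [wave_const_mul_sub huh hu h⁻¹ hp, wave_comp_rotST hu hij h hp,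
      heq _ (norm_rotST_fst_lt hij h hp), heq p hp]
    simp only [hG, rotST_apply]
    ring
  refine hen.trans (mul_le_mul_of_nonneg_left ?_ (exp_pos _).le)
  have hinit := setIntegral_Ann_initial_energy_le (ρ := (R + T) / 2) hR hij
    (contDiffOn_bottom hu) hh
  have hbot : ∀ y : E3, h⁻¹ * (u (rotST i j h (y, ‖y‖)) - u (y, ‖y‖)) =
      h⁻¹ * (u (rot i j h y, ‖rot i j h y‖) - u (y, ‖y‖)) := by
    intro y
    rw [rotST_apply, norm_rot hij]
  simp only [hbot]
  have hu2 : IntegrableOn (fun p => u (rotST i j h p) ^ 2) K :=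
    ((huh.continuousOn.pow 2).mono hKc).integrableOn_compact hK
  have hDF2 : IntegrableOn (fun p => (h⁻¹ * (F (rotST i j h p) - F p)) ^ 2) K :=
    ((hDF.continuousOn.pow 2).mono hKc).integrableOn_compact hK
  have hGle : ∫ p in K, G p ^ 2 ≤ 8 * T ^ 2 * M ^ 2 * (∫ p in K, u (rotST i j h p) ^ 2) +
      2 * ∫ p in K, (h⁻¹ * (F (rotST i j h p) - F p)) ^ 2 := by
    rw [← integral_const_mul, ← integral_const_mul,
      ← integral_add (hu2.const_mul _) (hDF2.const_mul _)]
    refine setIntegral_mono_on ((hGc.pow 2).integrableOn_compact hK)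
      ((hu2.const_mul _).add (hDF2.const_mul _)) hK.measurableSet fun p hp => ?_
    have hpA : p.1 ∈ Ann R ((R + T) / 2) := ⟨hp.1, hp.2.1⟩
    have h1 := sq_rot_quotient_le hq hij (N := 2 * T * M) (fun x hx =>
      abs_ang_le (hx.2.trans (by linarith)) (hqM x hx).2 i j) hh hpA
    have h2 := mul_le_mul_of_nonneg_right h1 (sq_nonneg (u (rotST i j h p)))
    simp only [hG]
    nlinarith [sq_nonneg (h⁻¹ * (q (rot i j h p.1) - q p.1) * u (rotST i j h p) -
      h⁻¹ * (F (rotST i j h p) - F p))]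
  have hinv : ∫ p in K, u (rotST i j h p) ^ 2 = ∫ p in K, u p ^ 2 :=
    setIntegral_comp_eq_of_invariant (ψ := fun p => u p ^ 2) hK.measurableSet
      (measurePreserving_rotST hij h) (fun p => rotST_mem_Kreg_iff hij h)
      ((hu.continuousOn.pow 2).mono hKc)
  have hDFle := setIntegral_Kreg_sq_rot_quotient_le (R := R) (T := T) (ρ := (R + T) / 2) hij hF hh
  rw [hinv] at hGle
  rw [← hKdef] at hDFle
  linarith

lemma fderivWithin_comp_fst_mul {q : E3 → ℝ} (hq : Differentiable ℝ q) {u : E3 × ℝ → ℝ}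
    (hu : ContDiffOn ℝ 1 u cone) {p : E3 × ℝ} (hp : ‖p.1‖ < p.2) (i j : Fin 3) :
    fderivWithin ℝ (fun p => q p.1 * u p) cone p (rotGen i j p.1, 0) =
      ang i j q p.1 * u p + q p.1 * angX i j u p := by
  have h1 := hasFDerivAt_of_contDiffOn_cone hu hp
  have h2 : HasFDerivAt (fun p : E3 × ℝ => q p.1)
      ((fderiv ℝ q p.1).comp (ContinuousLinearMap.fst ℝ E3 ℝ)) p :=
    (hq p.1).hasFDerivAt.comp p hasFDerivAt_fst
  have h3 : HasFDerivAt (fun p => q p.1 * u p) _ p := h2.mul h1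
  rw [h3.hasFDerivWithinAt.fderivWithin (uniqueDiffOn_cone p hp.le), angX,
    ang_eq_fderiv, ang_eq_fderiv, fderiv_fixT h1]
  simp
  ring

lemma sq_fderivWithin_source_le {R T M : ℝ} (hR : 0 < R) (hRT : R < T) (hM : 0 < M)
    {q : E3 → ℝ} (hq : Differentiable ℝ q) {u v : E3 × ℝ → ℝ} (hu : ContDiffOn ℝ 1 u cone)
    (hv : ∀ p : E3 × ℝ, v p = ‖p.1‖ * u p) {p : E3 × ℝ} (hpK : p ∈ Kreg R T ((R + T) / 2))
    (hp : ‖p.1‖ < p.2) (hvp : |v p| ≤ M) (hvk : ∀ k : Fin 3, |pdx k v p| ≤ M) (i j : Fin 3) :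
    (fderivWithin ℝ (fun p => q p.1 * u p) cone p (rotGen i j p.1, 0)) ^ 2 ≤
      2 * ((M + 2 * T * M) / R) ^ 2 * (q p.1 ^ 2 + ang i j q p.1 ^ 2) := by
  have hx0 : p.1 ≠ 0 := norm_pos_iff.1 (hR.trans_le hpK.1)
  have hT : 0 < T := hR.trans hRT
  rw [fderivWithin_comp_fst_mul hq hu hp]
  have hdu : DifferentiableAt ℝ (fixT u p.2) p.1 := by
    have h1 := hasFDerivAt_of_contDiffOn_cone hu hp
    exact DifferentiableAt.comp (g := u) (f := fun y => (y, p.2)) p.1 h1.differentiableAt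
      (by fun_prop)
  have hfix : fixT v p.2 = fun y => ‖y‖ * fixT u p.2 y := funext fun y => hv (y, p.2)
  have h2 : |ang i j (fixT v p.2) p.1| ≤ 2 * T * M :=
    abs_ang_le (hpK.2.1.trans (by linarith)) hvk i j
  rw [hfix, ang_norm_mul hx0 hdu, abs_mul, abs_norm] at h2
  rw [hv, abs_mul, abs_norm] at hvp
  have hTM : 0 < T * M := mul_pos hT hM
  have h3 : u p ^ 2 ≤ ((M + 2 * T * M) / R) ^ 2 := by
    refine sq_le_sq.2 ((le_div_iff₀ hR).2 ?_ |>.trans (le_abs_self _))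
    nlinarith [mul_le_mul_of_nonneg_right hpK.1 (abs_nonneg (u p))]
  have h4 : angX i j u p ^ 2 ≤ ((M + 2 * T * M) / R) ^ 2 := by
    refine sq_le_sq.2 ((le_div_iff₀ hR).2 ?_ |>.trans (le_abs_self _))
    have := mul_le_mul_of_nonneg_right hpK.1 (abs_nonneg (angX i j u p))
    simp only [angX] at *
    linarith
  have h5 := mul_le_mul_of_nonneg_left h3 (sq_nonneg (ang i j q p.1))
  have h6 := mul_le_mul_of_nonneg_left h4 (sq_nonneg (q p.1))
  nlinarith [sq_nonneg (ang i j q p.1 * u p - q p.1 * angX i j u p)]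

lemma setIntegral_source_le {R T M : ℝ} (hR : 0 < R) (hRT : R < T) (hM : 0 < M)
    {q : E3 → ℝ} (hq : ContDiff ℝ 1 q) (hp : ContDiffOn ℝ 2 (pfun q) {0}ᶜ)
    {u v : E3 × ℝ → ℝ} (hu : ContDiffOn ℝ 1 u cone)
    (hv : ∀ p : E3 × ℝ, v p = ‖p.1‖ * u p)
    (hvM : ∀ p ∈ Kreg R T ((R + T) / 2), |v p| ≤ M ∧ ∀ k : Fin 3, |pdx k v p| ≤ M)
    (i j : Fin 3) :
    ∫ p in Kreg R T ((R + T) / 2),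
        (fderivWithin ℝ (fun p => q p.1 * u p) cone p (rotGen i j p.1, 0)) ^ 2 ≤
      2 * ((M + 2 * T * M) / R) ^ 2 * (T - R) * ∫ x in Ann R ((R + T) / 2),
        (gradsq (pfun q) x + gradsq (ang i j (pfun q)) x) := by
  have hK : IsCompact (Kreg R T ((R + T) / 2)) := isCompact_Kreg R T _
  have hF : ContDiffOn ℝ 1 (fun p => q p.1 * u p) cone :=
    (hq.comp contDiff_fst).contDiffOn.mul hu
  have hcc : ContinuousOn (fun p : E3 × ℝ =>
      fderivWithin ℝ (fun p => q p.1 * u p) cone p (rotGen i j p.1, 0)) cone :=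
    (continuousOn_fderivWithin_cone hF).clm_apply (by fun_prop)
  have hi := integrableOn_gradsq_add_gradsq_ang (ρ := (R + T) / 2) hR hp i j
  have hg : ContinuousOn (fun x => gradsq (pfun q) x + gradsq (ang i j (pfun q)) x)
      (Ann R ((R + T) / 2)) :=
    ((continuousOn_gradsq (hp.of_le (by norm_num))).add
      (continuousOn_gradsq (contDiffOn_ang hp i j))).mono (Ann_subset_compl_zero hR)
  have h1 := setIntegral_Kreg_comp_fst_le (T := T) hg
    fun x => add_nonneg (gradsq_nonneg _ x) (gradsq_nonneg _ x)
  have hgK : IntegrableOn (fun p : E3 × ℝ => gradsq (pfun q) p.1 + gradsq (ang i j (pfun q)) p.1)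
      (Kreg R T ((R + T) / 2)) :=
    (hg.comp continuousOn_fst fun p hp => ⟨hp.1, hp.2.1⟩).integrableOn_compact hK
  have h2 : ∫ p in Kreg R T ((R + T) / 2),
        (fderivWithin ℝ (fun p => q p.1 * u p) cone p (rotGen i j p.1, 0)) ^ 2 ≤
      ∫ p in Kreg R T ((R + T) / 2), 2 * ((M + 2 * T * M) / R) ^ 2 *
        (gradsq (pfun q) p.1 + gradsq (ang i j (pfun q)) p.1) := by
    refine setIntegral_mono_ae_restrict
      (((hcc.pow 2).mono (Kreg_subset_cone R T _)).integrableOn_compact hK)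
      (hgK.const_mul _) ?_
    filter_upwards [ae_Kreg_interior R T ((R + T) / 2)] with p hp'
    have hx0 : p.1 ≠ 0 := norm_pos_iff.1 (hR.trans_le hp'.1.1)
    exact (sq_fderivWithin_source_le hR hRT hM (hq.differentiable one_ne_zero) hu hv hp'.1 hp'.2
      (hvM p hp'.1).1 (hvM p hp'.1).2 i j).trans
        (mul_le_mul_of_nonneg_left (sq_le_gradsq_pfun hq hx0 hp i j) (by positivity))
  rw [integral_const_mul] at h2
  refine h2.trans ?_
  rw [mul_assoc (2 * ((M + 2 * T * M) / R) ^ 2)]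
  exact mul_le_mul_of_nonneg_left h1 (by positivity)

lemma integral_le_of_tendsto_of_integral_le {α : Type*} [MeasurableSpace α] {μ : Measure α}
    {f : ℕ → α → ℝ} {g : α → ℝ} {C : ℝ} (hf : ∀ n, Integrable (f n) μ)
    (hf0 : ∀ n, 0 ≤ f n) (hC : ∀ n, ∫ x, f n x ∂μ ≤ C)
    (hlim : ∀ᵐ x ∂μ, Tendsto (fun n => f n x) atTop (𝓝 (g x))) : ∫ x, g x ∂μ ≤ C := by
  have hC0 : 0 ≤ C := (integral_nonneg (hf0 0)).trans (hC 0)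
  have hg0 : 0 ≤ᵐ[μ] g := by
    filter_upwards [hlim] with x hx using ge_of_tendsto' hx fun n => hf0 n x
  have hgm : AEStronglyMeasurable g μ :=
    aestronglyMeasurable_of_tendsto_ae atTop (fun n => (hf n).aestronglyMeasurable) hlim
  rw [integral_eq_lintegral_of_nonneg_ae hg0 hgm]
  refine ENNReal.toReal_le_of_le_ofReal hC0 ?_
  have h1 : ∫⁻ x, ENNReal.ofReal (g x) ∂μ =
      ∫⁻ x, liminf (fun n => ENNReal.ofReal (f n x)) atTop ∂μ := by
    refine lintegral_congr_ae ?_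
    filter_upwards [hlim] with x hx using (ENNReal.tendsto_ofReal hx).liminf_eq.symm
  rw [h1]
  refine (lintegral_liminf_le' fun n => (hf n).aemeasurable.ennreal_ofReal).trans ?_
  refine liminf_le_of_le (by isBoundedDefault) fun b hb => ?_
  obtain ⟨n, hn⟩ := hb.exists
  refine hn.trans ?_
  rw [← ofReal_integral_eq_lintegral_ofReal (hf n) (ae_of_all _ (hf0 n))]
  exact ENNReal.ofReal_le_ofReal (hC n)

lemma fderivWithin_comp_rotST {u : E3 × ℝ → ℝ} (hu : ContDiffOn ℝ 1 u cone) {i j : Fin 3}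
    (hij : i ≠ j) (s : ℝ) {p : E3 × ℝ} (hp : ‖p.1‖ < p.2) (v : E3 × ℝ) :
    fderivWithin ℝ (fun r => u (rotST i j s r)) cone p v =
      fderivWithin ℝ u cone (rotST i j s p) (rotST i j s v) := by
  have h1 := hasFDerivAt_of_contDiffOn_cone hu (norm_rotST_fst_lt hij s hp)
  have h2 : HasFDerivAt (fun r => u (rotST i j s r)) _ p :=
    HasFDerivAt.comp (g := u) p h1 (rotST i j s).hasFDerivAt
  rw [h2.hasFDerivWithinAt.fderivWithin (uniqueDiffOn_cone p hp.le)]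
  rfl

lemma contDiffOn_add_radial {u : E3 × ℝ → ℝ} (hu : ContDiffOn ℝ 2 u cone) :
    ContDiffOn ℝ 1 (fun p => u p + fderivWithin ℝ u cone p (p.1, 0)) cone :=
  (hu.of_le (by norm_num)).add
    ((hu.fderivWithin uniqueDiffOn_cone (by norm_num)).clm_apply
      (contDiff_fst.prodMk contDiff_const).contDiffOn)

lemma rot_quotient_add_radial {u : E3 × ℝ → ℝ} (hu : ContDiffOn ℝ 1 u cone) {i j : Fin 3}
    (hij : i ≠ j) (h : ℝ) {p : E3 × ℝ} (hp : ‖p.1‖ < p.2) :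
    h⁻¹ * ((u (rotST i j h p) +
        fderivWithin ℝ u cone (rotST i j h p) ((rotST i j h p).1, 0)) -
        (u p + fderivWithin ℝ u cone p (p.1, 0))) =
      h⁻¹ * (u (rotST i j h p) - u p) +
        fderivWithin ℝ (fun r => h⁻¹ * (u (rotST i j h r) - u r)) cone p (p.1, 0) := by
  have h1 := hasFDerivAt_of_contDiffOn_cone hu hp
  have h2 := hasFDerivAt_of_contDiffOn_cone (contDiffOn_comp_rotST hu hij h) hp
  have h3 : HasFDerivAt (fun r => h⁻¹ * (u (rotST i j h r) - u r)) _ p :=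
    (h2.sub h1).const_mul h⁻¹
  rw [h3.hasFDerivWithinAt.fderivWithin (uniqueDiffOn_cone p hp.le), smul_apply, sub_apply,
    fderivWithin_comp_rotST hu hij h hp]
  have h4 : rotST i j h (p.1, 0) = ((rotST i j h p).1, 0) := rfl
  rw [h4, smul_eq_mul]
  ring

lemma sq_add_radial_le {z : E3 × ℝ → ℝ} (hz : ContDiffOn ℝ 1 z cone) {p : E3 × ℝ}
    (hp : ‖p.1‖ < p.2) : (z p + fderivWithin ℝ z cone p (p.1, 0)) ^ 2 ≤
      2 * (1 + ‖p.1‖ ^ 2) * (z p ^ 2 + ∑ k, (fderivWithin ℝ z cone p (basis3 k, 0)) ^ 2) := by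
  have h1 := sq_fderiv_apply_le (fixT z p.2) p.1 p.1
  have h2 : gradsq (fixT z p.2) p.1 = ∑ k, (fderivWithin ℝ z cone p (basis3 k, 0)) ^ 2 :=
    Finset.sum_congr rfl fun k _ => by rw [← pdx_eq_fderivWithin hz hp, pdx]
  rw [fderiv_fixT (hasFDerivAt_of_contDiffOn_cone hz hp)] at h1
  have h3 := gradsq_nonneg (fixT z p.2) p.1
  rw [← h2]
  nlinarith [sq_nonneg (z p - fderivWithin ℝ z cone p (p.1, 0)),
    mul_nonneg (sq_nonneg ‖p.1‖) (sq_nonneg (z p))]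

lemma pdrX_norm_mul {u v : E3 × ℝ → ℝ} (hu : ContDiffOn ℝ 1 u cone)
    (hv : ∀ p : E3 × ℝ, v p = ‖p.1‖ * u p) {p : E3 × ℝ} (hx : p.1 ≠ 0) (hp : ‖p.1‖ < p.2) :
    pdrX v p = u p + fderivWithin ℝ u cone p (p.1, 0) := by
  have h1 := hasFDerivAt_of_contDiffOn_cone hu hp
  have hdu : DifferentiableAt ℝ (fixT u p.2) p.1 :=
    DifferentiableAt.comp (g := u) (f := fun y => (y, p.2)) p.1 h1.differentiableAt (by fun_prop)
  have hfix : fixT v p.2 = fun y => ‖y‖ * fixT u p.2 y := funext fun y => hv (y, p.2)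
  rw [pdrX, pdr_eq_fderiv, hfix, fderiv_norm_mul_self hx hdu, fderiv_fixT h1]
  rfl

lemma angX_pdrX_norm_mul {u v : E3 × ℝ → ℝ} (hu : ContDiffOn ℝ 2 u cone)
    (hv : ∀ p : E3 × ℝ, v p = ‖p.1‖ * u p) {p : E3 × ℝ} (hx : p.1 ≠ 0) (hp : ‖p.1‖ < p.2)
    (i j : Fin 3) :
    angX i j (pdrX v) p = fderivWithin ℝ (fun r => u r + fderivWithin ℝ u cone r (r.1, 0)) cone p
      (rotGen i j p.1, 0) := by
  have hu1 : ContDiffOn ℝ 1 u cone := hu.of_le (by norm_num)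
  have h1 : fixT (pdrX v) p.2 =ᶠ[𝓝 p.1]
      fixT (fun r => u r + fderivWithin ℝ u cone r (r.1, 0)) p.2 := by
    have h2 : ∀ᶠ y in 𝓝 p.1, ‖y‖ < p.2 :=
      (isOpen_lt continuous_norm continuous_const).mem_nhds
        (show p.1 ∈ {y : E3 | ‖y‖ < p.2} from hp)
    filter_upwards [h2, isOpen_compl_singleton.mem_nhds hx] with y hy hy0
    exact pdrX_norm_mul (p := (y, p.2)) hu1 hv hy0 hy
  rw [angX, ang_eq_fderiv, h1.fderiv_eq,
    fderiv_fixT (hasFDerivAt_of_contDiffOn_cone (contDiffOn_add_radial hu) hp)]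

lemma setIntegral_sq_angX_pdrX_le {R T B : ℝ} (hR : 0 < R) (hRT : R < T)
    {u v : E3 × ℝ → ℝ} (hu : ContDiffOn ℝ 2 u cone)
    (hv : ∀ p : E3 × ℝ, v p = ‖p.1‖ * u p) {i j : Fin 3} (hij : i ≠ j)
    (hB : ∀ h : ℝ, 0 < h →
      ∫ p in Kreg R T ((R + T) / 2), ((h⁻¹ * (u (rotST i j h p) - u p)) ^ 2 +
        ∑ k, (fderivWithin ℝ (fun p => h⁻¹ * (u (rotST i j h p) - u p)) cone p
          (basis3 k, 0)) ^ 2) ≤ B) :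
    ∫ p in Kreg R T ((R + T) / 2), (‖p.1‖ ^ 4)⁻¹ * (angX i j (pdrX v) p) ^ 2 ≤
      2 * (1 + T ^ 2) * (R ^ 4)⁻¹ * B := by
  have hK : IsCompact (Kreg R T ((R + T) / 2)) := isCompact_Kreg R T _
  have hKc : Kreg R T ((R + T) / 2) ⊆ cone := Kreg_subset_cone R T _
  have hu1 : ContDiffOn ℝ 1 u cone := hu.of_le (by norm_num)
  set Ψ : E3 × ℝ → ℝ := fun r => u r + fderivWithin ℝ u cone r (r.1, 0) with hΨ
  have hΨ1 : ContDiffOn ℝ 1 Ψ cone := contDiffOn_add_radial hu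
  set η : ℕ → ℝ := fun n => 1 / ((n : ℝ) + 1) with hη
  have hη0 : ∀ n, 0 < η n := fun n => Nat.one_div_pos_of_nat
  have hηlim : Tendsto η atTop (𝓝 0) := tendsto_one_div_add_atTop_nhds_zero_nat
  have hfint : ∀ n, IntegrableOn
      (fun p : E3 × ℝ => (‖p.1‖ ^ 4)⁻¹ * ((η n)⁻¹ * (Ψ (rotST i j (η n) p) - Ψ p)) ^ 2)
      (Kreg R T ((R + T) / 2)) := by
    intro n
    refine ContinuousOn.integrableOn_compact hK ?_
    have h1 : ContinuousOn (fun p : E3 × ℝ => (‖p.1‖ ^ 4)⁻¹) (Kreg R T ((R + T) / 2)) :=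
      ContinuousOn.inv₀ (by fun_prop) fun p hp => (pow_pos (hR.trans_le hp.1) 4).ne'
    exact h1.mul ((continuousOn_const.mul ((contDiffOn_comp_rotST hΨ1 hij (η n)).continuousOn.sub
      hΨ1.continuousOn)).mono hKc |>.pow 2)
  refine integral_le_of_tendsto_of_integral_le hfint (fun n p => by positivity) (fun n => ?_) ?_
  · have hz : ContDiffOn ℝ 1 (fun p => (η n)⁻¹ * (u (rotST i j (η n) p) - u p)) cone :=
      contDiffOn_const.mul ((contDiffOn_comp_rotST hu1 hij (η n)).sub hu1)
    have hzi : IntegrableOn (fun p => ((η n)⁻¹ * (u (rotST i j (η n) p) - u p)) ^ 2 +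
        ∑ k, (fderivWithin ℝ (fun p => (η n)⁻¹ * (u (rotST i j (η n) p) - u p)) cone p
          (basis3 k, 0)) ^ 2) (Kreg R T ((R + T) / 2)) := by
      refine ContinuousOn.integrableOn_compact hK (ContinuousOn.mono ?_ hKc)
      exact (hz.continuousOn.pow 2).add (continuousOn_finsetSum _ fun k _ =>
        ((continuousOn_fderivWithin_cone hz).clm_apply continuousOn_const).pow 2)
    refine le_trans ?_ (mul_le_mul_of_nonneg_left (hB (η n) (hη0 n)) (by positivity))
    rw [← integral_const_mul]
    refine setIntegral_mono_ae_restrict (hfint n) (hzi.const_mul _) ?_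
    filter_upwards [ae_Kreg_interior R T ((R + T) / 2)] with p hp
    have h1 := sq_add_radial_le hz hp.2
    have h2 := rot_quotient_add_radial hu1 hij (η n) hp.2
    simp only [hΨ]
    rw [h2]
    have hpT : ‖p.1‖ ≤ T := hp.1.2.1.trans (by linarith)
    have h3 : (‖p.1‖ ^ 4)⁻¹ ≤ (R ^ 4)⁻¹ :=
      inv_anti₀ (by positivity) (pow_le_pow_left₀ hR.le hp.1.1 4)
    have h4 : ‖p.1‖ ^ 2 ≤ T ^ 2 := pow_le_pow_left₀ (norm_nonneg _) hpT 2
    refine (mul_le_mul h3 (h1.trans (mul_le_mul_of_nonneg_right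
      (mul_le_mul_of_nonneg_left (add_le_add le_rfl h4) zero_le_two) (by positivity)))
      (sq_nonneg _) (by positivity)).trans (le_of_eq (by ring))
  · filter_upwards [ae_Kreg_interior R T ((R + T) / 2)] with p hp
    have hx0 : p.1 ≠ 0 := norm_pos_iff.1 (hR.trans_le hp.1.1)
    have h1 := hasDerivAt_comp_rotST hij hΨ1 hp.2 0
    have hp0 : rotST i j 0 p = p := by rw [rotST_apply, rot_zero]
    rw [hp0] at h1
    rw [angX_pdrX_norm_mul hu hv hx0 hp.2]
    have h2 := h1.tendsto_slope_zero.comp (tendsto_nhdsWithin_iff.2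
      ⟨hηlim, Eventually.of_forall fun n => (hη0 n).ne'⟩)
    simp only [zero_add, hp0, smul_eq_mul, Function.comp_def] at h2
    exact (h2.pow 2).const_mul _

lemma GoursatSol.wave_sub {q1 q2 : E3 → ℝ} {u1 u2 : E3 × ℝ → ℝ} (h1 : GoursatSol q1 u1)
    (h2 : GoursatSol q2 u2) {p : E3 × ℝ} (hp : ‖p.1‖ < p.2) :
    pdt (pdt fun r => u1 r - u2 r) p - lapX (fun r => u1 r - u2 r) p =
      q1 p.1 * (u1 p - u2 p) + (q1 - q2) p.1 * u2 p := by
  have h := wave_const_mul_sub h1.1 h2.1 1 hp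
  simp only [one_mul] at h
  rw [h, Pi.sub_apply]
  linear_combination h1.2.1 p hp - h2.2.1 p hp

lemma GoursatSol.pfun_sub_eq {q1 q2 : E3 → ℝ} (hq1 : Continuous q1) (hq2 : Continuous q2)
    {u1 u2 : E3 × ℝ → ℝ} (h1 : GoursatSol q1 u1) (h2 : GoursatSol q2 u2) :
    (fun y => ‖y‖ * (u1 (y, ‖y‖) - u2 (y, ‖y‖))) = pfun (q1 - q2) := by
  funext y
  have hi : ∀ {q : E3 → ℝ}, Continuous q →
      IntervalIntegrable (fun σ : ℝ => q (σ • y)) volume 0 1 := fun hq =>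
    (hq.comp (by fun_prop)).intervalIntegrable _ _
  rw [pfun_eq_norm_mul, h1.2.2, h2.2.2, ← intervalIntegral.integral_sub (hi hq1) (hi hq2)]
  rfl

lemma setIntegral_Ann_le_weighted {R T : ℝ} (hR : 0 < R) (hRT : R < T) {f : E3 → ℝ}
    (hf : ContDiffOn ℝ 2 f {0}ᶜ) (i j : Fin 3) :
    ∫ x in Ann R ((R + T) / 2), (gradsq f x + gradsq (ang i j f) x) ≤
      T ^ 2 * ∫ x in Ann R ((R + T) / 2),
        (‖x‖ ^ 2)⁻¹ * (f x ^ 2 + gradsq f x + gradsq (ang i j f) x) := by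
  have hc : ContinuousOn (fun x => (‖x‖ ^ 2)⁻¹ * (f x ^ 2 + gradsq f x + gradsq (ang i j f) x))
      (Ann R ((R + T) / 2)) := by
    refine ContinuousOn.mono (s := {0}ᶜ) ?_ (Ann_subset_compl_zero hR)
    have h1 : ContinuousOn (fun x : E3 => (‖x‖ ^ 2)⁻¹) {0}ᶜ :=
      ContinuousOn.inv₀ (by fun_prop) fun x hx => pow_ne_zero 2 (norm_ne_zero_iff.2 hx)
    exact h1.mul (((hf.continuousOn.pow 2).add
      (continuousOn_gradsq (hf.of_le (by norm_num)))).add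
        (continuousOn_gradsq (contDiffOn_ang hf i j)))
  rw [← integral_const_mul]
  refine setIntegral_mono_on (integrableOn_gradsq_add_gradsq_ang hR hf i j)
    ((hc.integrableOn_compact (isCompact_Ann R _)).const_mul _) (measurableSet_Ann R _)
    fun x hx => ?_
  have hx0 : 0 < ‖x‖ := hR.trans_le hx.1
  have h1 : 1 ≤ T ^ 2 * (‖x‖ ^ 2)⁻¹ := by
    rw [← div_eq_mul_inv, one_le_div (by positivity)]
    exact pow_le_pow_left₀ hx0.le (hx.2.trans (by linarith)) 2
  have h2 := add_nonneg (gradsq_nonneg f x) (gradsq_nonneg (ang i j f) x)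
  rw [← mul_assoc]
  nlinarith [sq_nonneg (f x)]

lemma angular_energy_estimate {R T M : ℝ} (hR : 0 < R) (hRT : R < T) (hM : 0 < M)
    {q1 q2 : E3 → ℝ} (hq1 : ContDiff ℝ 1 q1) (hq2 : ContDiff ℝ 1 q2)
    {u1 u2 : E3 × ℝ → ℝ} (h1 : GoursatSol q1 u1) (h2 : GoursatSol q2 u2)
    {v v2 : E3 × ℝ → ℝ} (hv : ∀ z : E3 × ℝ, v z = ‖z.1‖ * (u1 z - u2 z))
    (hv2 : ∀ z : E3 × ℝ, v2 z = ‖z.1‖ * u2 z)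
    (hqM : ∀ x ∈ Ann R ((R + T) / 2), |q1 x| ≤ M ∧ ∀ k : Fin 3, |pd k q1 x| ≤ M)
    (hvM : ∀ p ∈ Kreg R T ((R + T) / 2), |v2 p| ≤ M ∧ ∀ k : Fin 3, |pdx k v2 p| ≤ M)
    (hside : ∀ p : E3 × ℝ, ‖p.1‖ = R → R ≤ p.2 → p.2 ≤ T → v p = 0)
    {i j : Fin 3} (hij : i ≠ j) :
    (∫ p in Kreg R T ((R + T) / 2), (‖p.1‖ ^ 4)⁻¹ * (angX i j (pdrX v) p) ^ 2) ≤
      2 * (1 + T ^ 2) * (R ^ 4)⁻¹ * (exp ((3 + 2 * M ^ 2) * T) *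
        ((4 + 24 * (R ^ 2)⁻¹ + 8 * ((M + 2 * T * M) / R) ^ 2 * (T - R)) * T ^ 2 +
          16 * T ^ 2 * M ^ 2)) *
        ((∫ x in Ann R ((R + T) / 2), (‖x‖ ^ 2)⁻¹ *
            ((pfun (q1 - q2) x) ^ 2 + gradsq (pfun (q1 - q2)) x
              + gradsq (ang i j (pfun (q1 - q2))) x)) +
          ∫ p in Kreg R T ((R + T) / 2), (‖p.1‖ ^ 2)⁻¹ * (v p) ^ 2) := by
  have hu : ContDiffOn ℝ 2 (fun p => u1 p - u2 p) cone := h1.1.sub h2.1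
  have hu2 : ContDiffOn ℝ 1 u2 cone := h2.1.of_le (by norm_num)
  have hq : ContDiff ℝ 1 (q1 - q2) := hq1.sub hq2
  have hpe := GoursatSol.pfun_sub_eq hq1.continuous hq2.continuous h1 h2
  have hp : ContDiffOn ℝ 2 (pfun (q1 - q2)) {0}ᶜ := by
    rw [← hpe]
    exact contDiffOn_norm_mul (contDiffOn_bottom hu)
  have hu0 : ∀ x : E3, ‖x‖ = R → ∀ t, R < t → t < T → u1 (x, t) - u2 (x, t) = 0 := by
    intro x hx t ht1 ht2
    have h := hside (x, t) hx ht1.le ht2.le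
    rw [hv] at h
    exact (mul_eq_zero.1 h).resolve_left (by rw [hx]; exact hR.ne')
  have hF : ContDiffOn ℝ 1 (fun p => (q1 - q2) p.1 * u2 p) cone :=
    (hq.comp contDiff_fst).contDiffOn.mul hu2
  have hsrc := setIntegral_source_le hR hRT hM hq hp hu2 hv2 hvM i j
  have hI1 := setIntegral_Ann_le_weighted hR hRT hp i j
  have hI2 : ∫ p in Kreg R T ((R + T) / 2), (u1 p - u2 p) ^ 2 =
      ∫ p in Kreg R T ((R + T) / 2), (‖p.1‖ ^ 2)⁻¹ * (v p) ^ 2 := by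
    refine setIntegral_congr_fun (isCompact_Kreg R T _).measurableSet fun p hp => ?_
    have hx0 : ‖p.1‖ ≠ 0 := (hR.trans_le hp.1).ne'
    simp only [hv]
    field_simp
  have hI2' : 0 ≤ ∫ p in Kreg R T ((R + T) / 2), (‖p.1‖ ^ 2)⁻¹ * (v p) ^ 2 :=
    integral_nonneg fun p => by positivity
  have hI1' : 0 ≤ ∫ x in Ann R ((R + T) / 2), (‖x‖ ^ 2)⁻¹ *
      ((pfun (q1 - q2) x) ^ 2 + gradsq (pfun (q1 - q2)) x
        + gradsq (ang i j (pfun (q1 - q2))) x) :=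
    integral_nonneg fun x => mul_nonneg (by positivity)
      (add_nonneg (add_nonneg (sq_nonneg _) (gradsq_nonneg _ _)) (gradsq_nonneg _ _))
  have hTR : 0 < T - R := sub_pos.2 hRT
  refine (setIntegral_sq_angX_pdrX_le hR hRT hu hv hij fun h hh =>
    rot_quotient_energy_le hR hRT hij hq1 hqM hu hF (fun p hp => h1.wave_sub h2 hp) hu0 hh).trans ?_
  rw [hpe, hI2, mul_assoc (2 * (1 + T ^ 2) * (R ^ 4)⁻¹), mul_assoc (exp _)]
  refine mul_le_mul_of_nonneg_left (mul_le_mul_of_nonneg_left ?_ (exp_pos _).le) (by positivity)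
  have hk : 0 ≤ 4 + 24 * (R ^ 2)⁻¹ + 8 * ((M + 2 * T * M) / R) ^ 2 * (T - R) := by positivity
  have h5 := mul_le_mul_of_nonneg_left hI1 hk
  have h6 := mul_nonneg (mul_nonneg hk (sq_nonneg T)) hI2'
  have h7 := mul_nonneg (show 0 ≤ 16 * T ^ 2 * M ^ 2 by positivity) hI1'
  linarith

/-- **estimate (2.15).** The angular energy estimate: with
`v = |x|(u₁ − u₂)` having vanishing Cauchy data on the cylinder, the weighted `L²` norm
of `Ω_{ij} ∂_r v` on `K` is controlled by `p`, its angular derivative and `v`, with a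
constant depending only on `R`, `T` and the `C¹` norms of `q₁` on `A` and `v₂` on `K`. -/
theorem stmt16 (R T M : ℝ) (hR : 0 < R) (hRT : R < T) (hM : 0 < M) :
    ∃ c > (0:ℝ), ∀ q1 q2 : E3 → ℝ, ContDiff ℝ 8 q1 → ContDiff ℝ 8 q2 →
      ∀ u1 u2 : E3 × ℝ → ℝ, GoursatSol q1 u1 → GoursatSol q2 u2 →
      ∀ v v2 : E3 × ℝ → ℝ,
        (∀ z : E3 × ℝ, v z = ‖z.1‖ * (u1 z - u2 z)) →
        (∀ z : E3 × ℝ, v2 z = ‖z.1‖ * u2 z) →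
        (∀ x ∈ Ann R ((R + T) / 2), |q1 x| ≤ M ∧ ∀ k : Fin 3, |pd k q1 x| ≤ M) →
        (∀ p ∈ Kreg R T ((R + T) / 2),
          |v2 p| ≤ M ∧ |pdt v2 p| ≤ M ∧ ∀ k : Fin 3, |pdx k v2 p| ≤ M) →
        (∀ p : E3 × ℝ, ‖p.1‖ = R → R ≤ p.2 → p.2 ≤ T → v p = 0 ∧ pdrX v p = 0) →
        ∀ i j : Fin 3, i < j →
        (∫ p in Kreg R T ((R + T) / 2), (‖p.1‖ ^ 4)⁻¹ * (angX i j (pdrX v) p) ^ 2)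
        ≤ c * (T - R) * (R ^ 2)⁻¹ *
            ((∫ x in Ann R ((R + T) / 2), (‖x‖ ^ 2)⁻¹ *
                ((pfun (q1 - q2) x) ^ 2 + gradsq (pfun (q1 - q2)) x
                  + gradsq (ang i j (pfun (q1 - q2))) x))
             + ∫ p in Kreg R T ((R + T) / 2), (‖p.1‖ ^ 2)⁻¹ * (v p) ^ 2) := by
  have hTR : 0 < T - R := sub_pos.2 hRT
  have hT : 0 < T := hR.trans hRT
  set C : ℝ := 2 * (1 + T ^ 2) * (R ^ 4)⁻¹ * (exp ((3 + 2 * M ^ 2) * T) *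
    ((4 + 24 * (R ^ 2)⁻¹ + 8 * ((M + 2 * T * M) / R) ^ 2 * (T - R)) * T ^ 2 +
      16 * T ^ 2 * M ^ 2)) with hC
  have hC0 : 0 < C := by positivity
  refine ⟨C * R ^ 2 / (T - R), by positivity, ?_⟩
  intro q1 q2 hq1 hq2 u1 u2 h1 h2 v v2 hv hv2 hqM hvM hside i j hij
  have hc : C * R ^ 2 / (T - R) * (T - R) * (R ^ 2)⁻¹ = C := by
    field_simp
  rw [hc]
  exact angular_energy_estimate hR hRT hM (hq1.of_le (by norm_num)) (hq2.of_le (by norm_num))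
    h1 h2 hv hv2 hqM (fun p hp => ⟨(hvM p hp).1, (hvM p hp).2.2⟩)
    (fun p h3 h4 h5 => (hside p h3 h4 h5).1) hij.ne
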